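/- arXiv:1206.0725 — 5 statements merged into one kernel-verified Lean document; each statement's English description precedes it below -/
import Mathlib

section
/- Let f be a holomorphic injective map on the open unit disc 𝔻 = {z ∈ ℂ : |z| < 1} with f(0) = w and f'(0) = c a positive real number. Then for every ζ ∈ 𝔻, c·|ζ|/(1+|ζ|)² ≤ |f(ζ) − w| ≤ c·|ζ|/(1−|ζ|)². -/
open Metric Set

namespace Koebe
open Filter Topology MeasureTheory

lemma isPreconnected_lt_norm {r : ℝ} (hr : 0 < r) : IsPreconnected {z : ℂ | r < ‖z‖} := by
  have h : {z : ℂ | r < ‖z‖} = Complex.exp '' {w | Real.log r < w.re} := by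
    ext z
    constructor
    · intro hz
      have hz' : r < ‖z‖ := hz
      have h0 : z ≠ 0 := norm_pos_iff.1 (hr.trans hz')
      exact ⟨Complex.log z, by simpa [Complex.log_re] using Real.log_lt_log hr hz',
        Complex.exp_log h0⟩
    · rintro ⟨w, hw, rfl⟩
      have hw' : Real.log r < w.re := hw
      simpa [Complex.norm_exp] using (Real.log_lt_iff_lt_exp hr).1 hw'
  rw [h]
  exact (convex_halfSpace_re_gt _).isPreconnected.image _ Complex.continuous_exp.continuousOn

lemma isPreconnected_punctured_ball : IsPreconnected (ball (0 : ℂ) 1 \ {0}) := by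
  have h : ball (0 : ℂ) 1 \ {0} = Complex.exp '' {w | w.re < 0} := by
    ext z
    constructor
    · rintro ⟨hz, h0⟩
      have hz : ‖z‖ < 1 := by simpa using hz
      have h0 : z ≠ 0 := h0
      exact ⟨Complex.log z, by
        simpa [Complex.log_re] using Real.log_neg (norm_pos_iff.2 h0) hz, Complex.exp_log h0⟩
    · rintro ⟨w, hw, rfl⟩
      have hw' : w.re < 0 := hw
      simp [Complex.norm_exp, hw']
  rw [h]
  exact (convex_halfSpace_re_lt _).isPreconnected.image _ Complex.continuous_exp.continuousOn

lemma norm_le_of_norm_le_on_circle {G : ℂ → ℂ} {δ R : ℝ} (hδ : 0 < δ) (hR : 0 < R)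
    (hcont : ContinuousOn G (ball 0 1 \ {0})) (hinj : InjOn G (ball 0 1 \ {0}))
    (hopen : ∀ s ⊆ ball 0 1 \ {0}, IsOpen s → IsOpen (G '' s))
    (hinf : Tendsto (fun z => ‖G z‖) (𝓝[≠] 0) atTop)
    (hcirc : ∀ z, ‖z‖ = δ → ‖G z‖ ≤ R) {z : ℂ} (hz : δ < ‖z‖) (hz1 : ‖z‖ < 1) :
    ‖G z‖ ≤ R := by
  have hδ1 : δ < 1 := hz.trans hz1
  by_contra! hlt
  set S : Set ℂ := ball 0 δ \ {0} with hS
  have hSsub : S ⊆ ball 0 1 \ {0} := sdiff_subset_sdiff_left (ball_subset_ball hδ1.le)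
  have hSopen : IsOpen (G '' S) := hopen S hSsub (isOpen_ball.sdiff isClosed_singleton)
  have hev : ∀ a : ℝ, ∃ η > 0, ∀ y : ℂ, ‖y‖ < η → y ≠ 0 → a < ‖G y‖ := by
    intro a
    have := hinf.eventually (eventually_gt_atTop a)
    rw [eventually_nhdsWithin_iff, Metric.eventually_nhds_iff] at this
    obtain ⟨η, h1, h2⟩ := this
    exact ⟨η, h1, fun y hy hy0 => h2 (by simpa using hy) hy0⟩
  have hsub : {y : ℂ | R < ‖y‖} ⊆ G '' S := by
    refine (isPreconnected_lt_norm hR).subset_of_closure_inter_subset hSopen ?_ ?_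
    · obtain ⟨η, h1, h2⟩ := hev R
      have hm : 0 < min η δ := lt_min h1 hδ
      have hn : ‖((min η δ / 2 : ℝ) : ℂ)‖ = min η δ / 2 := by
        rw [Complex.norm_real, Real.norm_of_nonneg (by positivity)]
      have h0 : ((min η δ / 2 : ℝ) : ℂ) ≠ 0 := norm_pos_iff.1 (by rw [hn]; positivity)
      refine ⟨_, h2 ((min η δ / 2 : ℝ) : ℂ) ?_ h0, mem_image_of_mem _ ⟨?_, h0⟩⟩
      · rw [hn]; linarith [min_le_left η δ]
      · rw [mem_ball_zero_iff, hn]; linarith [min_le_right η δ]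
    · rintro y ⟨hy, hyR⟩
      have hyR : R < ‖y‖ := hyR
      obtain ⟨η, h1, h2⟩ := hev (‖y‖ + 1)
      set K : Set ℂ := closedBall 0 δ \ ball 0 η
      have hKsub : K ⊆ ball 0 1 \ {0} := by
        rintro x ⟨hx, hx'⟩
        refine ⟨closedBall_subset_ball hδ1 hx, ?_⟩
        rintro rfl
        exact hx' (mem_ball_self h1)
      have hK : IsCompact (G '' K) :=
        ((isCompact_closedBall (0 : ℂ) δ).diff isOpen_ball).image_of_continuousOn (hcont.mono hKsub)
      have hcl : G '' S ⊆ {x | ‖y‖ + 1 ≤ ‖x‖} ∪ G '' K := by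
        rintro _ ⟨x, ⟨hx, hx0⟩, rfl⟩
        by_cases hxη : ‖x‖ < η
        · exact Or.inl (h2 x hxη hx0).le
        · exact Or.inr ⟨x, ⟨ball_subset_closedBall hx, by simpa using hxη⟩, rfl⟩
      have := closure_minimal hcl
        ((isClosed_le continuous_const continuous_norm).union hK.isClosed) hy
      rcases this with h | ⟨x, hx, rfl⟩
      · have : ‖y‖ + 1 ≤ ‖y‖ := h
        linarith
      · refine ⟨x, ⟨?_, (hKsub hx).2⟩, rfl⟩
        have h3 : ‖x‖ ≤ δ := by simpa using hx.1
        have h4 : ‖x‖ ≠ δ := fun h => (hcirc x h).not_gt hyR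
        simpa using lt_of_le_of_ne h3 h4
  obtain ⟨x, hx, hxz⟩ := hsub hlt
  have h0 : z ≠ 0 := norm_pos_iff.1 (hδ.trans hz)
  have := hinj (hSsub hx) ⟨by simpa using hz1, h0⟩ hxz
  subst this
  have : ‖x‖ < δ := by simpa using hx.1
  linarith

lemma isOpen_image_of_injOn {G : ℂ → ℂ} (hG : DifferentiableOn ℂ G (ball 0 1 \ {0}))
    (hinj : InjOn G (ball 0 1 \ {0})) {s : Set ℂ} (hs : s ⊆ ball 0 1 \ {0}) (hso : IsOpen s) :
    IsOpen (G '' s) := by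
  refine ((hG.analyticOnNhd (isOpen_ball.sdiff isClosed_singleton)).is_constant_or_isOpen
    isPreconnected_punctured_ball).resolve_left ?_ s hs hso
  rintro ⟨w, hw⟩
  have h1 : (1 / 2 : ℂ) ∈ ball (0 : ℂ) 1 \ {0} := by constructor <;> norm_num
  have h2 : (1 / 3 : ℂ) ∈ ball (0 : ℂ) 1 \ {0} := by constructor <;> norm_num
  have := hinj h1 h2 ((hw _ h1).trans (hw _ h2).symm)
  norm_num at this

lemma lintegral_norm_deriv_sq_eq_volume_image {G : ℂ → ℂ} {s : Set ℂ} (hs : IsOpen s)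
    (hG : DifferentiableOn ℂ G s) (hinj : InjOn G s) :
    ∫⁻ z in s, ENNReal.ofReal (‖deriv G z‖ ^ 2) = volume (G '' s) := by
  rw [← lintegral_abs_det_fderiv_eq_addHaar_image volume hs.measurableSet (f' := fun z =>
    ((ContinuousLinearMap.toSpanSingleton ℂ (deriv G z)).restrictScalars ℝ)) ?_ hinj]
  · congr with z
    congr 1
    have : (ContinuousLinearMap.toSpanSingleton ℂ (deriv G z)).det = deriv G z := by
      simp [ContinuousLinearMap.det]
    simp only [ContinuousLinearMap.det] at this ⊢
    rw [ContinuousLinearMap.coe_restrictScalars, LinearMap.det_restrictScalars, this, Algebra.norm_complex_eq]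
    simp [Complex.normSq_eq_norm_sq]
  · intro z hz
    exact ((hG.differentiableAt (hs.mem_nhds hz)).hasDerivAt.hasFDerivAt.restrictScalars
      ℝ).hasFDerivWithinAt

lemma le_lintegral_annulus {u : ℂ → ℝ} {m : ℝ → ℝ} {δ : ℝ} (hδ : 0 < δ)
    (hu : ContinuousOn u {z | δ < ‖z‖ ∧ ‖z‖ < 1}) (hu0 : ∀ z, 0 ≤ u z)
    (hm : ∀ r, δ < r → r < 1 → m r ≤ ∫ θ in (-Real.pi)..Real.pi, u (circleMap 0 r θ)) :
    ∫⁻ r in Ioo δ 1, ENNReal.ofReal (r * m r) ≤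
      ∫⁻ z in {z | δ < ‖z‖ ∧ ‖z‖ < 1}, ENNReal.ofReal (u z) := by
  have hA : IsOpen {z : ℂ | δ < ‖z‖ ∧ ‖z‖ < 1} :=
    (isOpen_lt continuous_const continuous_norm).inter
      (isOpen_lt continuous_norm continuous_const)
  have hmeas : Measurable ({z : ℂ | δ < ‖z‖ ∧ ‖z‖ < 1}.indicator fun z => ENNReal.ofReal (u z)) := by
    have h1 : ContinuousOn (fun z => ENNReal.ofReal (u z)) {z | δ < ‖z‖ ∧ ‖z‖ < 1} :=
      ENNReal.continuous_ofReal.comp_continuousOn hu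
    have := h1.measurable_piecewise (g := fun _ => 0) continuousOn_const hA.measurableSet
    convert this using 1
    exact (piecewise_eq_indicator).symm
  rw [← lintegral_indicator hA.measurableSet, ← Complex.lintegral_comp_polarCoord_symm,
    polarCoord_target, Measure.volume_eq_prod, setLIntegral_prod]
  · refine (lintegral_mono' (Measure.restrict_mono (s' := Ioi 0) (fun x (hx : x ∈ Ioo δ 1) => hδ.trans hx.1) le_rfl)
      (fun r => le_rfl)).trans' ?_
    refine setLIntegral_mono' measurableSet_Ioo fun r hr => ?_
    have hr0 : 0 < r := hδ.trans hr.1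
    have hpt : ∀ θ : ℝ, Complex.polarCoord.symm (r, θ) = circleMap 0 r θ := fun θ => by
      simp [circleMap, Complex.exp_mul_I]
    have hmem : ∀ θ, circleMap 0 r θ ∈ {z : ℂ | δ < ‖z‖ ∧ ‖z‖ < 1} := fun θ => by
      simp [abs_of_pos hr0, hr.1, hr.2]
    simp_rw [hpt, indicator_of_mem (hmem _), smul_eq_mul]
    rw [lintegral_const_mul' _ _ ENNReal.ofReal_ne_top, ENNReal.ofReal_mul hr0.le]
    gcongr
    have hc : Continuous fun θ => u (circleMap 0 r θ) :=
      hu.comp_continuous (continuous_circleMap 0 r) hmem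
    rw [← ofReal_integral_eq_lintegral_ofReal]
    · refine ENNReal.ofReal_le_ofReal ((hm r hr.1 hr.2).trans_eq ?_)
      rw [intervalIntegral.integral_of_le (by linarith [Real.pi_pos]), integral_Ioc_eq_integral_Ioo]
    · exact (hc.integrableOn_Icc (a := -Real.pi) (b := Real.pi)).mono_set Ioo_subset_Icc_self
    · exact ae_of_all _ fun θ => hu0 _
  · refine Measurable.aemeasurable ?_
    refine (ENNReal.measurable_ofReal.comp measurable_fst).mul (hmeas.comp ?_)
    have : Continuous fun p : ℝ × ℝ => (Complex.polarCoord.symm p : ℂ) := by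
      simp only [Complex.polarCoord_symm_apply]; fun_prop
    exact this.measurable

lemma two_pi_mul_le_integral_norm_sq {k : ℂ → ℂ} (hk : DifferentiableOn ℂ k (ball 0 1))
    (hk0 : k 0 = -1) {r : ℝ} (hr0 : 0 < r) (hr1 : r < 1) :
    2 * Real.pi * (1 + ‖deriv k 0‖ ^ 2 * r ^ 4) ≤
      ∫ θ in (-Real.pi)..Real.pi, ‖k (circleMap 0 r θ ^ 2)‖ ^ 2 := by
  set b := deriv k 0 with hb
  set m := dslope k 0 with hm
  have hmd : DifferentiableOn ℂ m (ball 0 1) :=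
    (Complex.differentiableOn_dslope (ball_mem_nhds 0 one_pos)).2 hk
  have hm0 : m 0 = b := dslope_same k 0
  have hkm : ∀ u, k u = -1 + u * m u := fun u => by
    have := sub_smul_dslope k 0 u
    rw [hk0, sub_zero, smul_eq_mul] at this
    rw [hm, this]; ring
  have hsq : MapsTo (fun z : ℂ => z ^ 2) (ball 0 1) (ball 0 1) := fun z hz => by
    have : ‖z‖ < 1 := by simpa using hz
    simpa using pow_lt_one₀ (norm_nonneg z) this two_ne_zero
  have hm2 : DifferentiableOn ℂ (fun z => m (z ^ 2)) (ball 0 1) :=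
    hmd.comp (by fun_prop) hsq
  set Φ : ℂ → ℂ := fun z => 2 * (1 - z ^ 2 * m (z ^ 2) + r ^ 4 * m (z ^ 2) * starRingEnd ℂ b) -
    (1 + ‖b‖ ^ 2 * r ^ 4) with hΦ
  have hΦd : DifferentiableOn ℂ Φ (ball 0 1) := by
    rw [hΦ]; fun_prop
  have hΦ0 : Φ 0 = ((1 + ‖b‖ ^ 2 * r ^ 4 : ℝ) : ℂ) := by
    simp only [hΦ]
    have := Complex.mul_conj' b
    simp only [ne_eq, OfNat.ofNat_ne_zero, not_false_eq_true, zero_pow, hm0]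
    push_cast
    linear_combination 2 * (r : ℂ) ^ 4 * this
  have hle : ∀ z : ℂ, ‖z‖ = r → (Φ z).re ≤ ‖k (z ^ 2)‖ ^ 2 := by
    intro z hz
    have h1 : ‖z ^ 2‖ ^ 2 = r ^ 4 := by rw [norm_pow, hz]; ring
    rw [hkm]
    simp only [hΦ]
    generalize z ^ 2 = u at *
    generalize m u = c at *
    have h2 : 0 ≤ r ^ 4 * ‖c - b‖ ^ 2 := by positivity
    simp only [← Complex.normSq_eq_norm_sq, Complex.normSq_apply] at *
    have e : ((r : ℂ) ^ 4) = ((r ^ 4 : ℝ) : ℂ) := by push_cast; ring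
    have e' : (‖b‖ : ℂ) ^ 2 = ((b.re * b.re + b.im * b.im : ℝ) : ℂ) := by
      rw [← Complex.normSq_apply, Complex.normSq_eq_norm_sq]; push_cast; ring
    rw [e, e']
    rw [← h1] at h2 ⊢
    simp at h2 ⊢
    nlinarith
  have hcl : closedBall (0 : ℂ) r ⊆ ball 0 1 := closedBall_subset_ball hr1
  have hmem : ∀ θ, circleMap 0 r θ ∈ ball (0 : ℂ) 1 := fun θ => by
    simpa [abs_of_pos hr0] using hr1
  have hΦc : Continuous fun θ => Φ (circleMap 0 r θ) :=
    hΦd.continuousOn.comp_continuous (continuous_circleMap 0 r) hmem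
  have hkc : Continuous fun θ => ‖k (circleMap 0 r θ ^ 2)‖ ^ 2 :=
    ((hk.continuousOn.comp_continuous ((continuous_circleMap 0 r).pow 2)
      fun θ => hsq (hmem θ)).norm).pow 2
  have havg : Real.circleAverage Φ 0 r = Φ 0 := by
    refine DiffContOnCl.circleAverage ?_
    rw [abs_of_pos hr0]
    exact hΦd.diffContOnCl_ball hcl
  have hint : ∫ θ in (-Real.pi)..Real.pi, Φ (circleMap 0 r θ) = 2 * Real.pi * Φ 0 := by
    have hper : Function.Periodic (fun θ => Φ (circleMap 0 r θ)) (2 * Real.pi) := fun θ => by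
      simp only [periodic_circleMap 0 r θ]
    have := hper.intervalIntegral_add_eq (-Real.pi) 0
    rw [show -Real.pi + 2 * Real.pi = Real.pi by ring, zero_add] at this
    rw [this, ← havg, Real.circleAverage_def, Complex.real_smul]
    push_cast
    have : (Real.pi : ℂ) ≠ 0 := by exact_mod_cast Real.pi_ne_zero
    field_simp
  calc 2 * Real.pi * (1 + ‖b‖ ^ 2 * r ^ 4)
      = (∫ θ in (-Real.pi)..Real.pi, Φ (circleMap 0 r θ)).re := by
        rw [hint, hΦ0, ← Complex.ofReal_ofNat, ← Complex.ofReal_mul, ← Complex.ofReal_mul,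
          Complex.ofReal_re]
    _ = ∫ θ in (-Real.pi)..Real.pi, (Φ (circleMap 0 r θ)).re :=
        (Complex.reCLM.intervalIntegral_comp_comm (hΦc.intervalIntegrable _ _)).symm
    _ ≤ _ := by
        refine intervalIntegral.integral_mono (by linarith [Real.pi_pos])
          ((Complex.continuous_re.comp hΦc).intervalIntegrable _ _)
          (hkc.intervalIntegrable _ _) fun θ => hle _ ?_
        simp [abs_of_pos hr0]

/-- The real-linear map `w ↦ w + a * conj w`, which maps circles about `0` to ellipses. -/
noncomputable def ellipseMap (a : ℂ) : ℂ →ₗ[ℝ] ℂ :=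
  LinearMap.id + (LinearMap.mulLeft ℝ a).comp Complex.conjAe.toLinearMap

lemma ellipseMap_apply (a w : ℂ) : ellipseMap a w = w + a * starRingEnd ℂ w := rfl

lemma det_ellipseMap (a : ℂ) : LinearMap.det (ellipseMap a) = 1 - ‖a‖ ^ 2 := by
  rw [← LinearMap.det_toMatrix Complex.basisOneI, Matrix.det_fin_two,
    ← Complex.normSq_eq_norm_sq, Complex.normSq_apply]
  simp [LinearMap.toMatrix_apply, ellipseMap_apply]
  ring

lemma norm_le_norm_ellipseMap {a : ℂ} (ha : ‖a‖ ≤ 1 / 2) (w : ℂ) :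
    ‖w‖ / 2 ≤ ‖ellipseMap a w‖ := by
  have h := norm_sub_le_norm_add w (a * starRingEnd ℂ w)
  rw [norm_mul, RCLike.norm_conj] at h
  rw [ellipseMap_apply]
  nlinarith [norm_nonneg w]

lemma norm_ellipseMap_le {a : ℂ} (ha : ‖a‖ ≤ 1 / 2) (w : ℂ) :
    ‖ellipseMap a w‖ ≤ 2 * ‖w‖ := by
  have h := norm_add_le w (a * starRingEnd ℂ w)
  rw [norm_mul, RCLike.norm_conj] at h
  rw [ellipseMap_apply]
  nlinarith [norm_nonneg w]

lemma lintegral_Ioo_ofReal_inv_cube_add {δ c : ℝ} (hδ : 0 < δ) (hδ1 : δ < 1) (hc : 0 ≤ c) :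
    ∫⁻ r in Ioo δ 1, ENNReal.ofReal (r * (2 * Real.pi * (1 + c * r ^ 4) / r ^ 4)) =
      ENNReal.ofReal (Real.pi * (1 / δ ^ 2 - 1 + c * (1 - δ ^ 2))) := by
  set F : ℝ → ℝ := fun r => Real.pi * (c * r ^ 2 - 1 / r ^ 2)
  set g : ℝ → ℝ := fun r => r * (2 * Real.pi * (1 + c * r ^ 4) / r ^ 4)
  have hpos : ∀ r ∈ uIcc δ 1, 0 < r := fun r hr => by
    rw [uIcc_of_le hδ1.le] at hr; exact hδ.trans_le hr.1
  have hF : ∀ r ∈ uIcc δ 1, HasDerivAt F (g r) r := fun r hr => by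
    have h0 := (hpos r hr).ne'
    have h1 : HasDerivAt (fun r : ℝ => r ^ 2) (2 * r) r := by simpa using hasDerivAt_pow 2 r
    have := ((h1.const_mul c).sub ((hasDerivAt_const r (1 : ℝ)).div h1 (by positivity))).const_mul
      Real.pi
    refine this.congr_deriv ?_
    simp only [g]; field_simp; ring
  have hg : ContinuousOn g (uIcc δ 1) := by
    refine continuousOn_id.mul (ContinuousOn.div (by fun_prop) (by fun_prop) fun r hr => ?_)
    exact pow_ne_zero _ (hpos r hr).ne'
  have hgi := hg.intervalIntegrable (μ := volume)
  have hint := intervalIntegral.integral_eq_sub_of_hasDerivAt hF hgi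
  rw [intervalIntegrable_iff_integrableOn_Ioo_of_le hδ1.le] at hgi
  rw [intervalIntegral.integral_of_le hδ1.le, integral_Ioc_eq_integral_Ioo] at hint
  rw [← ofReal_integral_eq_lintegral_ofReal hgi, hint]
  · congr 1; simp only [F]; ring
  · refine (ae_restrict_iff' measurableSet_Ioo).2 (ae_of_all _ fun r hr => ?_)
    have : 0 < r := hδ.trans hr.1
    simp only [g, Pi.zero_apply]; positivity

section AreaTheorem

variable {h : ℂ → ℂ}

lemma sq_mem_ball {z : ℂ} (hz : z ∈ ball (0 : ℂ) 1) : z ^ 2 ∈ ball (0 : ℂ) 1 := by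
  have : ‖z‖ < 1 := by simpa using hz
  simpa using pow_lt_one₀ (norm_nonneg z) this two_ne_zero

lemma hasDerivAt_comp_sq_div (hh : DifferentiableOn ℂ h (ball 0 1)) {z : ℂ}
    (hz : z ∈ ball (0 : ℂ) 1 \ {0}) :
    HasDerivAt (fun z => h (z ^ 2) / z) ((2 * z ^ 2 * deriv h (z ^ 2) - h (z ^ 2)) / z ^ 2) z := by
  have hz0 : z ≠ 0 := hz.2
  have h1 := (hh.differentiableAt (isOpen_ball.mem_nhds (sq_mem_ball hz.1))).hasDerivAt
  have h2 : HasDerivAt (fun z : ℂ => z ^ 2) (2 * z) z := by simpa using hasDerivAt_pow 2 z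
  refine ((h1.comp z h2).div (hasDerivAt_id z) hz0).congr_deriv ?_
  simp only [Function.comp_apply, id]
  ring

lemma tendsto_norm_comp_sq_div (hh : DifferentiableOn ℂ h (ball 0 1)) (h0 : h 0 = 1) :
    Tendsto (fun z => ‖h (z ^ 2) / z‖) (𝓝[≠] 0) atTop := by
  have h1 : Tendsto (fun z : ℂ => ‖h (z ^ 2)‖) (𝓝[≠] 0) (𝓝 1) := by
    have hc : ContinuousAt h (0 ^ 2) := by
      simpa using hh.continuousOn.continuousAt (ball_mem_nhds 0 one_pos)
    have : ContinuousAt (fun z : ℂ => ‖h (z ^ 2)‖) 0 :=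
      (ContinuousAt.comp (f := fun z : ℂ => z ^ 2) hc (by fun_prop)).norm
    simpa [ContinuousAt, h0] using this.tendsto.mono_left nhdsWithin_le_nhds
  have h2 : Tendsto (fun z : ℂ => ‖z‖⁻¹) (𝓝[≠] 0) atTop :=
    tendsto_inv_nhdsGT_zero.comp tendsto_norm_nhdsNE_zero
  refine (h1.pos_mul_atTop one_pos h2).congr fun z => ?_
  rw [norm_div, div_eq_mul_inv]

lemma exists_norm_sub_le_on_circle (hh : DifferentiableOn ℂ h (ball 0 1)) (h0 : h 0 = 1) :
    ∃ C > 0, ∀ δ : ℝ, 0 < δ → δ ≤ 1 / 2 → ∀ z : ℂ, ‖z‖ = δ →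
      ‖h (z ^ 2) / z - ellipseMap (deriv h 0 * δ ^ 2) z⁻¹‖ ≤ C * δ ^ 3 := by
  have hn : ball (0 : ℂ) 1 ∈ 𝓝 0 := ball_mem_nhds 0 one_pos
  have hd : DifferentiableOn ℂ (dslope (dslope h 0) 0) (ball 0 1) :=
    (Complex.differentiableOn_dslope hn).2 ((Complex.differentiableOn_dslope hn).2 hh)
  obtain ⟨C, hC⟩ := (isCompact_closedBall (0 : ℂ) (1 / 2)).exists_bound_of_continuousOn
    (hd.continuousOn.mono (closedBall_subset_ball (by norm_num)))
  refine ⟨max C 1, by positivity, fun δ hδ hδ2 z hz => ?_⟩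
  have hz0 : z ≠ 0 := norm_pos_iff.1 (by rw [hz]; exact hδ)
  have hexp : ∀ u, h u = 1 + deriv h 0 * u + u ^ 2 * dslope (dslope h 0) 0 u := fun u => by
    have h1 := sub_smul_dslope h 0 u
    have h2 := sub_smul_dslope (dslope h 0) 0 u
    rw [dslope_same] at h2
    simp only [sub_zero, smul_eq_mul, h0] at h1 h2
    linear_combination -h1 - u * h2
  have hconj : (δ : ℂ) ^ 2 * starRingEnd ℂ z⁻¹ = z := by
    have : starRingEnd ℂ z ≠ 0 := by simpa using hz0
    rw [map_inv₀, ← hz, ← Complex.mul_conj']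
    field_simp
  have heq : h (z ^ 2) / z - ellipseMap (deriv h 0 * δ ^ 2) z⁻¹ =
      z ^ 3 * dslope (dslope h 0) 0 (z ^ 2) := by
    rw [ellipseMap_apply, mul_assoc, hconj, hexp (z ^ 2)]
    field_simp
    ring
  rw [heq, norm_mul, norm_pow, hz, mul_comm]
  gcongr
  refine (hC _ ?_).trans (le_max_left _ _)
  rw [mem_closedBall_zero_iff, norm_pow, hz]
  nlinarith

lemma norm_deriv_sq_le_of_injOn_comp_sq_div (hh : DifferentiableOn ℂ h (ball 0 1)) (h0 : h 0 = 1)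
    (hinj : InjOn (fun z => h (z ^ 2) / z) (ball 0 1 \ {0})) {C δ : ℝ} (hC : 0 < C) (hδ : 0 < δ)
    (hδ2 : δ ≤ 1 / 2) (hb : ‖deriv h 0‖ * δ ^ 2 ≤ 1 / 2)
    (hcirc : ∀ z : ℂ, ‖z‖ = δ →
      ‖h (z ^ 2) / z - ellipseMap (deriv h 0 * δ ^ 2) z⁻¹‖ ≤ C * δ ^ 3) :
    ‖deriv h 0‖ ^ 2 ≤
      1 + ‖deriv h 0‖ ^ 2 * δ ^ 2 + 4 * C * δ ^ 2 + 4 * C ^ 2 * δ ^ 6 := by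
  set b := deriv h 0 with hbdef
  set G : ℂ → ℂ := fun z => h (z ^ 2) / z with hG
  have hδ1 : δ < 1 := by linarith
  have hGder : ∀ z ∈ ball (0 : ℂ) 1 \ {0}, HasDerivAt G _ z := fun z hz =>
    hasDerivAt_comp_sq_div hh hz
  have hGd : DifferentiableOn ℂ G (ball 0 1 \ {0}) := fun z hz =>
    (hGder z hz).differentiableAt.differentiableWithinAt
  set a : ℂ := b * δ ^ 2 with ha
  have hna : ‖a‖ ≤ 1 / 2 := by
    rw [ha, norm_mul, norm_pow, Complex.norm_real, Real.norm_of_nonneg hδ.le]; exact hb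
  have hdet : LinearMap.det (ellipseMap a) ≠ 0 := by
    rw [det_ellipseMap]; nlinarith [norm_nonneg a]
  set L : ℂ ≃L[ℝ] ℂ := ((ellipseMap a).equivOfDetNeZero hdet).toContinuousLinearEquiv with hL
  have hLapp : ∀ w, L w = ellipseMap a w := fun w => rfl
  set R : ℝ := 1 / δ + 2 * (C * δ ^ 3) with hR
  have hRpos : 0 < R := by positivity
  have hsymm : ∀ w, ‖L.symm w‖ / 2 ≤ ‖w‖ := fun w => by
    simpa [← hLapp] using norm_le_norm_ellipseMap hna (L.symm w)
  have hsymm' : ∀ w, ‖w‖ / 2 ≤ ‖L.symm w‖ := fun w => by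
    have := norm_ellipseMap_le hna (L.symm w)
    rw [← hLapp, L.apply_symm_apply] at this
    linarith
  set A : Set ℂ := {z | δ < ‖z‖ ∧ ‖z‖ < 1} with hA
  have hAsub : A ⊆ ball 0 1 \ {0} := fun z hz =>
    ⟨by simpa using hz.2, norm_pos_iff.1 (hδ.trans hz.1)⟩
  have hAopen : IsOpen A := (isOpen_lt continuous_const continuous_norm).inter
    (isOpen_lt continuous_norm continuous_const)
  have himage : G '' A ⊆ ellipseMap a '' closedBall 0 R := by
    rintro _ ⟨z, hz, rfl⟩
    refine ⟨L.symm (G z), ?_, L.apply_symm_apply _⟩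
    rw [mem_closedBall_zero_iff]
    refine norm_le_of_norm_le_on_circle (G := fun z => L.symm (G z)) hδ hRpos
      (L.symm.continuous.comp_continuousOn hGd.continuousOn)
      (L.symm.injective.comp_injOn hinj) (fun s hs hso => ?_) ?_ (fun z hz => ?_) hz.1 hz.2
    · have := L.symm.toHomeomorph.isOpenMap _ (isOpen_image_of_injOn hGd hinj hs hso)
      rwa [image_image] at this
    · exact tendsto_atTop_mono (fun z => hsymm' _)
        ((tendsto_norm_comp_sq_div hh h0).atTop_div_const two_pos)
    · have h1 : L.symm (G z) = z⁻¹ + L.symm (G z - ellipseMap a z⁻¹) := by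
        rw [map_sub, ← hLapp, L.symm_apply_apply]; ring
      rw [h1]
      refine (norm_add_le _ _).trans ?_
      rw [norm_inv, hz, hR, one_div]
      linarith [hsymm (G z - ellipseMap a z⁻¹), hcirc z hz]
  have hupper : volume (G '' A) ≤ ENNReal.ofReal (Real.pi * R ^ 2) := by
    refine (measure_mono himage).trans ?_
    rw [Measure.addHaar_image_linearMap, Complex.volume_closedBall, det_ellipseMap]
    have h1 : ENNReal.ofReal |1 - ‖a‖ ^ 2| ≤ 1 := by
      rw [ENNReal.ofReal_le_one, abs_le]
      constructor <;> nlinarith [norm_nonneg a]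
    refine (mul_le_of_le_one_left zero_le h1).trans_eq ?_
    rw [mul_comm, ENNReal.ofReal_mul Real.pi_pos.le, ENNReal.ofReal_pow hRpos.le]
    congr 1
    rw [← NNReal.coe_real_pi, ENNReal.ofReal_coe_nnreal]
  set k : ℂ → ℂ := fun u => 2 * u * deriv h u - h u with hk
  have hdh : DifferentiableOn ℂ (deriv h) (ball 0 1) := hh.deriv isOpen_ball
  have hkd : DifferentiableOn ℂ k (ball 0 1) := by rw [hk]; fun_prop
  have hk0 : k 0 = -1 := by simp [hk, h0]
  have hkb : deriv k 0 = b := by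
    have hn : ball (0 : ℂ) 1 ∈ 𝓝 0 := ball_mem_nhds 0 one_pos
    have h1 := ((hasDerivAt_id (0 : ℂ)).const_mul 2).mul (hdh.differentiableAt hn).hasDerivAt
    refine (h1.sub (hh.differentiableAt hn).hasDerivAt).deriv.trans ?_
    simp [← hbdef]
    ring
  have hlower : ENNReal.ofReal (Real.pi * (1 / δ ^ 2 - 1 + ‖b‖ ^ 2 * (1 - δ ^ 2))) ≤
      volume (G '' A) := by
    rw [← lintegral_norm_deriv_sq_eq_volume_image hAopen (hGd.mono hAsub) (hinj.mono hAsub),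
      ← lintegral_Ioo_ofReal_inv_cube_add hδ hδ1 (sq_nonneg ‖b‖)]
    refine le_lintegral_annulus hδ ?_ (fun z => sq_nonneg _) fun r hr hr1 => ?_
    · exact (((hGd.mono hAsub).deriv hAopen).continuousOn.norm).pow 2
    · have hr0 : 0 < r := hδ.trans hr
      rw [div_le_iff₀ (by positivity), ← intervalIntegral.integral_mul_const]
      refine (hkb ▸ two_pi_mul_le_integral_norm_sq hkd hk0 hr0 hr1).trans_eq ?_
      refine intervalIntegral.integral_congr fun θ _ => ?_
      have hnorm : ‖circleMap 0 r θ‖ = r := by simp [abs_of_pos hr0]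
      have hmem : circleMap 0 r θ ∈ ball (0 : ℂ) 1 \ {0} :=
        hAsub ⟨by rw [hnorm]; exact hr, by rw [hnorm]; exact hr1⟩
      simp only [(hGder _ hmem).deriv, norm_div, norm_pow, hnorm, hk]
      field_simp
  have hfin := (ENNReal.ofReal_le_ofReal_iff (by positivity)).1 (hlower.trans hupper)
  have hfin' := le_of_mul_le_mul_left hfin Real.pi_pos
  have hRsq : R ^ 2 = 1 / δ ^ 2 + 4 * C * δ ^ 2 + 4 * C ^ 2 * δ ^ 6 := by
    rw [hR]; field_simp; ring
  rw [hRsq] at hfin'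
  linarith

/-- **Area theorem** for odd functions: if `z ↦ h (z ^ 2) / z = 1 / z + h' 0 * z + ⋯` is injective
on the punctured unit disc, then `‖h' 0‖ ≤ 1`. -/
theorem norm_deriv_le_one_of_injOn_comp_sq_div (hh : DifferentiableOn ℂ h (ball 0 1))
    (h0 : h 0 = 1) (hinj : InjOn (fun z => h (z ^ 2) / z) (ball 0 1 \ {0})) :
    ‖deriv h 0‖ ≤ 1 := by
  obtain ⟨C, hC, hcirc⟩ := exists_norm_sub_le_on_circle hh h0
  set B := ‖deriv h 0‖
  have hlim : Tendsto (fun δ : ℝ => 1 + B ^ 2 * δ ^ 2 + 4 * C * δ ^ 2 + 4 * C ^ 2 * δ ^ 6)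
      (𝓝[>] 0) (𝓝 1) := by
    have : Continuous fun δ : ℝ => 1 + B ^ 2 * δ ^ 2 + 4 * C * δ ^ 2 + 4 * C ^ 2 * δ ^ 6 := by
      fun_prop
    simpa using (this.tendsto 0).mono_left nhdsWithin_le_nhds
  have hsmall : ∀ᶠ δ : ℝ in 𝓝[>] 0, B * δ ^ 2 < 1 / 2 := by
    have : Continuous fun δ : ℝ => B * δ ^ 2 := by fun_prop
    exact ((this.tendsto 0).mono_left nhdsWithin_le_nhds).eventually_lt_const (by norm_num)
  have hhalf : ∀ᶠ δ : ℝ in 𝓝[>] 0, δ < 1 / 2 :=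
    (Filter.Tendsto.mono_left tendsto_id nhdsWithin_le_nhds).eventually_lt_const (by norm_num)
  have hle : B ^ 2 ≤ 1 := by
    refine ge_of_tendsto hlim ?_
    filter_upwards [hsmall, hhalf, self_mem_nhdsWithin] with δ h1 h2 h3
    exact norm_deriv_sq_le_of_injOn_comp_sq_div hh h0 hinj hC h3 h2.le h1.le
      (hcirc δ h3 h2.le)
  exact (sq_le_one_iff₀ (norm_nonneg _)).1 hle

end AreaTheorem


lemma exists_sq_mul_eq_one {F : ℂ → ℂ} (hF : DifferentiableOn ℂ F (ball 0 1))
    (hne : ∀ z ∈ ball (0 : ℂ) 1, F z ≠ 0) (hF0 : F 0 = 1) :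
    ∃ h : ℂ → ℂ, DifferentiableOn ℂ h (ball 0 1) ∧ h 0 = 1 ∧
      (∀ z ∈ ball (0 : ℂ) 1, h z ^ 2 * F z = 1) ∧ deriv h 0 = -deriv F 0 / 2 := by
  have hdF : DifferentiableOn ℂ (deriv F) (ball 0 1) := hF.deriv isOpen_ball
  obtain ⟨g, hg0, hg⟩ := (hdF.div hF hne).isExactOn_ball.with_val_at 0 0
  have hder : ∀ z ∈ ball (0 : ℂ) 1,
      HasDerivAt (fun z => Complex.exp (-g z / 2))
        (Complex.exp (-g z / 2) * (-(deriv F z / F z) / 2)) z :=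
    fun z hz => ((hg z hz).neg.div_const 2).cexp
  have hconst : ∀ z ∈ ball (0 : ℂ) 1,
      HasDerivAt (fun z => Complex.exp (-g z / 2) ^ 2 * F z) 0 z := fun z hz => by
    have h1 := ((hder z hz).pow 2).mul (hF.differentiableAt (isOpen_ball.mem_nhds hz)).hasDerivAt
    refine h1.congr_deriv ?_
    have := hne z hz
    simp only [Pi.pow_apply, Nat.cast_ofNat]
    field_simp
    ring
  refine ⟨fun z => Complex.exp (-g z / 2),
    fun z hz => (hder z hz).differentiableAt.differentiableWithinAt, by simp [hg0],
    fun z hz => ?_, ?_⟩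
  · have := isOpen_ball.is_const_of_deriv_eq_zero (convex_ball (0 : ℂ) 1).isPreconnected
      (fun z hz => (hconst z hz).differentiableAt.differentiableWithinAt)
      (fun z hz => (hconst z hz).deriv) hz (mem_ball_self one_pos)
    rw [this]
    simp [hg0, hF0]
  · rw [(hder 0 (mem_ball_self one_pos)).deriv]
    simp [hg0, hF0]

/-- **Bieberbach's bound** on the second coefficient of the univalent function `z ↦ z * F z`. -/
theorem norm_deriv_le_two_of_injOn_mul {F : ℂ → ℂ} (hF : DifferentiableOn ℂ F (ball 0 1))
    (hF0 : F 0 = 1) (hinj : InjOn (fun z => z * F z) (ball 0 1)) : ‖deriv F 0‖ ≤ 2 := by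
  have hne : ∀ z ∈ ball (0 : ℂ) 1, F z ≠ 0 := fun z hz h => by
    have : z = 0 := hinj hz (mem_ball_self one_pos) (by simp [h])
    rw [this, hF0] at h
    exact one_ne_zero h
  obtain ⟨h, hh, h0, hsq, hd⟩ := exists_sq_mul_eq_one hF hne hF0
  have := norm_deriv_le_one_of_injOn_comp_sq_div hh h0 ?_
  · rw [hd, norm_div, norm_neg, Complex.norm_two] at this
    linarith
  · rintro z ⟨hz, hz0⟩ w ⟨hw, hw0⟩ hzw
    have hz0 : z ≠ 0 := hz0
    have hw0 : w ≠ 0 := hw0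
    have h1 := hsq _ (sq_mem_ball hz)
    have h2 := hsq _ (sq_mem_ball hw)
    simp only [] at hzw
    rw [div_eq_div_iff hz0 hw0] at hzw
    have h3 : h (z ^ 2) ≠ 0 := fun h => by simp [h] at h1
    have h4 : h (w ^ 2) ≠ 0 := fun h => by simp [h] at h2
    have hsqeq : z ^ 2 = w ^ 2 := by
      refine hinj (sq_mem_ball hz) (sq_mem_ball hw) ?_
      have h5 : F (z ^ 2) = 1 / h (z ^ 2) ^ 2 := by rw [eq_div_iff (pow_ne_zero 2 h3), ← h1]; ring
      have h6 : F (w ^ 2) = 1 / h (w ^ 2) ^ 2 := by rw [eq_div_iff (pow_ne_zero 2 h4), ← h2]; ring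
      simp only [h5, h6]
      field_simp
      linear_combination -(h (z ^ 2) * w + h (w ^ 2) * z) * hzw
    rw [hsqeq] at hzw
    exact (mul_left_cancel₀ h4 hzw).symm

/-- **Koebe quarter theorem**. -/
theorem norm_deriv_le_four_mul_norm_sub {f : ℂ → ℂ} (hf : DifferentiableOn ℂ f (ball 0 1))
    (hinj : InjOn f (ball 0 1)) {v : ℂ} (hv : v ∉ f '' ball 0 1) :
    ‖deriv f 0‖ ≤ 4 * ‖v - f 0‖ := by
  by_cases hc : deriv f 0 = 0
  · rw [hc, norm_zero]; positivity
  set c := deriv f 0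
  have hn : ball (0 : ℂ) 1 ∈ 𝓝 0 := ball_mem_nhds 0 one_pos
  set F : ℂ → ℂ := fun z => dslope f 0 z / c with hFdef
  have hF : DifferentiableOn ℂ F (ball 0 1) :=
    ((Complex.differentiableOn_dslope hn).2 hf).div_const c
  have hF0 : F 0 = 1 := by simp only [hFdef, dslope_same]; exact div_self hc
  have hfF : ∀ z, f z = f 0 + c * (z * F z) := fun z => by
    have := sub_smul_dslope f 0 z
    rw [sub_zero, smul_eq_mul] at this
    simp only [hFdef]
    field_simp
    linear_combination -this
  have hinjF : InjOn (fun z => z * F z) (ball 0 1) := fun x hx y hy hxy =>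
    hinj hx hy (by rw [hfF x, hfF y]; exact congrArg (fun t => f 0 + c * t) hxy)
  set w := (v - f 0) / c with hw
  have hvw : v = f 0 + c * w := by rw [hw]; field_simp; ring
  have hw0 : w ≠ 0 := fun h => hv ⟨0, mem_ball_self one_pos, by rw [hvw, h]; ring⟩
  have hden : ∀ z ∈ ball (0 : ℂ) 1, 1 - z * F z / w ≠ 0 := fun z hz h => by
    refine hv ⟨z, hz, ?_⟩
    have : z * F z = w := by field_simp at h; linear_combination -h
    rw [hfF, hvw, this]
  set E : ℂ → ℂ := fun z => F z / (1 - z * F z / w) with hE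
  have hEd : DifferentiableOn ℂ E (ball 0 1) := hF.div (by fun_prop) hden
  have hE' : deriv E 0 = deriv F 0 + 1 / w := by
    have h1 := (hF.differentiableAt hn).hasDerivAt
    have h2 := (((hasDerivAt_id (0 : ℂ)).mul h1).div_const w).const_sub 1
    refine (h1.div h2 (by simp)).deriv.trans ?_
    simp [hF0]
  have hinjE : InjOn (fun z => z * E z) (ball 0 1) := fun x hx y hy hxy => by
    refine hinjF hx hy ?_
    have h1 := hden x hx
    have h2 := hden y hy
    simp only [hE, ← mul_div_assoc] at hxy
    rw [div_eq_div_iff h1 h2] at hxy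
    simp only
    linear_combination hxy
  have hb1 := norm_deriv_le_two_of_injOn_mul hF hF0 hinjF
  have hb2 := norm_deriv_le_two_of_injOn_mul hEd (by simp [hE, hF0]) hinjE
  have hb3 : ‖1 / w‖ ≤ 4 := by
    have : 1 / w = deriv E 0 - deriv F 0 := by rw [hE']; ring
    rw [this]
    linarith [norm_sub_le (deriv E 0) (deriv F 0)]
  have hvn : v - f 0 ≠ 0 := fun h => hw0 (by rw [hw, h, zero_div])
  rw [hw, one_div, inv_div, norm_div, div_le_iff₀ (norm_pos_iff.2 hvn)] at hb3
  exact hb3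

lemma re_sqrt_pos {z : ℂ} (hz : z ∈ Complex.slitPlane) : 0 < (Complex.sqrt z).re := by
  rw [Complex.sqrt, Complex.cpow_inv_two_re]
  refine Real.sqrt_pos.2 (div_pos ?_ two_pos)
  rcases Complex.mem_slitPlane_iff.1 hz with h | h
  · linarith [norm_nonneg z]
  · linarith [neg_abs_le z.re, Complex.abs_re_lt_norm.2 h]

lemma sq_sqrt (z : ℂ) : Complex.sqrt z ^ 2 = z := by
  simp [Complex.sqrt]

lemma re_one_add_div_one_sub_pos {z : ℂ} (hz : z ∈ ball (0 : ℂ) 1) :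
    0 < ((1 + z) / (1 - z)).re := by
  have hz1 : ‖z‖ < 1 := by simpa using hz
  have hne : 1 - z ≠ 0 := fun h => by
    rw [← sub_eq_zero.1 h] at hz1; simp at hz1
  have h1 : Complex.normSq z < 1 := by
    rw [Complex.normSq_eq_norm_sq]; nlinarith [norm_nonneg z]
  rw [Complex.normSq_apply] at h1
  rw [Complex.div_re, ← add_div]
  refine div_pos ?_ (Complex.normSq_pos.2 hne)
  simp
  nlinarith

lemma norm_sub_one_div_add_one_lt {s : ℂ} (hs : 0 < s.re) : ‖(s - 1) / (s + 1)‖ < 1 := by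
  have hne : s + 1 ≠ 0 := fun h => by
    have := congrArg Complex.re h
    simp at this; linarith
  rw [norm_div, div_lt_one (norm_pos_iff.2 hne), ← sq_lt_sq₀ (norm_nonneg _) (norm_nonneg _),
    ← Complex.normSq_eq_norm_sq, ← Complex.normSq_eq_norm_sq, Complex.normSq_apply,
    Complex.normSq_apply]
  simp
  nlinarith

/-- A Riemann map of the disc slit along the segment from `-1` to `-r`. -/
lemma exists_slit_disc_map {r : ℝ} (hr0 : 0 < r) (hr1 : r < 1) :
    ∃ φ : ℂ → ℂ, DifferentiableOn ℂ φ (ball 0 1) ∧ InjOn φ (ball 0 1) ∧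
      MapsTo φ (ball 0 1) (ball 0 1) ∧ φ 0 = 0 ∧
      HasDerivAt φ ((4 * r / (1 + r) ^ 2 : ℝ) : ℂ) 0 ∧ ∀ z ∈ ball (0 : ℂ) 1, φ z ≠ -r := by
  set t : ℝ := 4 * r / (1 + r) ^ 2 with ht
  have ht0 : 0 < t := by positivity
  have ht1 : t ≤ 1 := by rw [ht, div_le_one (by positivity)]; nlinarith [sq_nonneg (1 - r)]
  have htc : (t : ℂ) ≠ 0 := by exact_mod_cast ht0.ne'
  set q : ℂ → ℂ := fun z => (1 + z) / (1 - z) with hq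
  have hqre : ∀ z ∈ ball (0 : ℂ) 1, 0 < (q z).re := fun z hz => re_one_add_div_one_sub_pos hz
  have hne : ∀ z ∈ ball (0 : ℂ) 1, 1 - z ≠ 0 := fun z hz h => by
    rw [← sub_eq_zero.1 h] at hz; simp at hz
  have hqd : DifferentiableOn ℂ q (ball 0 1) :=
    DifferentiableOn.div (by fun_prop) (by fun_prop) hne
  set p : ℂ → ℂ := fun z => 1 - t + t * q z ^ 2 with hp
  have hpslit : ∀ z ∈ ball (0 : ℂ) 1, p z ∈ Complex.slitPlane := fun z hz => by
    have h := hqre z hz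
    rw [Complex.mem_slitPlane_iff, or_iff_not_imp_right, not_not]
    simp only [hp, sq]
    intro h1
    simp at h1 ⊢
    have h2 : (q z).im = 0 := by
      rcases h1 with h1 | h1
      · exact absurd h1 ht0.ne'
      · nlinarith
    rw [h2]
    nlinarith [mul_pos ht0 (mul_pos h h)]
  set s : ℂ → ℂ := fun z => Complex.sqrt (p z) with hs
  have hsre : ∀ z ∈ ball (0 : ℂ) 1, 0 < (s z).re := fun z hz => re_sqrt_pos (hpslit z hz)
  have hssq : ∀ z, s z ^ 2 = 1 - t + t * q z ^ 2 := fun z => sq_sqrt _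
  have hs1 : ∀ z ∈ ball (0 : ℂ) 1, s z + 1 ≠ 0 := fun z hz h => by
    have := congrArg Complex.re h
    simp at this
    linarith [hsre z hz]
  have hpd : DifferentiableOn ℂ p (ball 0 1) := by rw [hp]; fun_prop
  have hsd : DifferentiableOn ℂ s (ball 0 1) := Complex.differentiableOn_sqrt.comp hpd hpslit
  have h0 : (0 : ℂ) ∈ ball (0 : ℂ) 1 := mem_ball_self one_pos
  have hp0 : p 0 = 1 := by simp [hp, hq]
  have hs0 : s 0 = 1 := by simp [hs, hp0, Complex.sqrt]
  refine ⟨fun z => (s z - 1) / (s z + 1), (hsd.sub_const 1).div (hsd.add_const 1) hs1, ?_,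
    fun z hz => mem_ball_zero_iff.2 (norm_sub_one_div_add_one_lt (hsre z hz)), by simp [hs0],
    ?_, ?_⟩
  · intro x hx y hy hxy
    simp only at hxy
    rw [div_eq_div_iff (hs1 x hx) (hs1 y hy)] at hxy
    have hsxy : s x = s y := by linear_combination hxy / 2
    have h1 : q x ^ 2 = q y ^ 2 := by
      refine mul_left_cancel₀ htc ?_
      have h2 := hssq x
      rw [hsxy, hssq y] at h2
      linear_combination -h2
    have h2 : q x = q y := by
      rcases sq_eq_sq_iff_eq_or_eq_neg.1 h1 with h | h
      · exact h
      · have := congrArg Complex.re h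
        simp only [Complex.neg_re] at this
        linarith [hqre x hx, hqre y hy]
    simp only [hq] at h2
    rw [div_eq_div_iff (hne x hx) (hne y hy)] at h2
    linear_combination h2 / 2
  · have hq0 : HasDerivAt q 2 0 := by
      refine (((hasDerivAt_id (0 : ℂ)).const_add 1).div ((hasDerivAt_id (0 : ℂ)).const_sub 1)
        (by simp)).congr_deriv ?_
      norm_num
    have hpder : HasDerivAt p (4 * t) 0 := by
      refine (((hq0.pow 2).const_mul (t : ℂ)).const_add (1 - (t : ℂ))).congr_deriv ?_
      simp [hq]; ring
    have hsder : HasDerivAt s (2 * t) 0 := by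
      refine ((Complex.hasDerivAt_sqrt (hpslit 0 h0)).comp 0 hpder).congr_deriv ?_
      rw [hp0, Complex.one_cpow]; ring
    refine ((hsder.sub_const 1).div (hsder.add_const 1) (hs1 0 h0)).congr_deriv ?_
    rw [hs0]; norm_num; ring
  · intro z hz h
    have hr : (1 + r : ℂ) ≠ 0 := by exact_mod_cast (by positivity : (1 + r : ℝ) ≠ 0)
    rw [div_eq_iff (hs1 z hz)] at h
    have h1 : (1 + r) * s z = 1 - r := by linear_combination h
    have h2 : (1 + (r : ℂ)) ^ 2 * t = 4 * r := by
      rw [ht]; push_cast; field_simp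
    have h3 : q z = 0 := by
      have : (1 + (r : ℂ)) ^ 2 * t * q z ^ 2 = 0 := by
        linear_combination ((1 + r) * s z + (1 - r)) * h1 - (1 + (r : ℂ)) ^ 2 * hssq z + h2
      simpa [hr, htc] using this
    have := hqre z hz
    rw [h3] at this
    simp at this

/-- The lower bound of the growth theorem. -/
theorem norm_deriv_mul_div_le_norm_sub {f : ℂ → ℂ} (hf : DifferentiableOn ℂ f (ball 0 1))
    (hinj : InjOn f (ball 0 1)) {ζ : ℂ} (hζ : ζ ∈ ball (0 : ℂ) 1) :
    ‖deriv f 0‖ * ‖ζ‖ / (1 + ‖ζ‖) ^ 2 ≤ ‖f ζ - f 0‖ := by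
  by_cases h0 : ζ = 0
  · simp [h0]
  have hr0 : 0 < ‖ζ‖ := norm_pos_iff.2 h0
  have hrc : (‖ζ‖ : ℂ) ≠ 0 := by exact_mod_cast hr0.ne'
  obtain ⟨φ, hφd, hφi, hφm, hφ0, hφ', hφne⟩ := exists_slit_disc_map hr0 (by simpa using hζ)
  set e : ℂ := -(ζ / ‖ζ‖) with he
  have he0 : e ≠ 0 := neg_ne_zero.2 (div_ne_zero h0 hrc)
  have hen : ‖e‖ = 1 := by
    rw [he, norm_neg, norm_div, Complex.norm_real, norm_norm, div_self hr0.ne']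
  have hm : MapsTo (fun z => e * φ z) (ball 0 1) (ball 0 1) := fun z hz => by
    simpa [hen] using hφm hz
  have hv : f ζ ∉ (fun z => f (e * φ z)) '' ball 0 1 := by
    rintro ⟨z, hz, hzζ⟩
    have h1 : e * φ z = ζ := hinj (hm hz) hζ hzζ
    refine hφne z hz (mul_left_cancel₀ he0 (h1.trans ?_))
    rw [he]; field_simp
  have hder : HasDerivAt (fun z => f (e * φ z))
      (deriv f 0 * (e * ((4 * ‖ζ‖ / (1 + ‖ζ‖) ^ 2 : ℝ) : ℂ))) 0 := by
    have h1 : HasDerivAt f (deriv f 0) (e * φ 0) := by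
      rw [hφ0, mul_zero]
      exact (hf.differentiableAt (ball_mem_nhds 0 one_pos)).hasDerivAt
    exact h1.comp 0 (hφ'.const_mul e)
  have hq := norm_deriv_le_four_mul_norm_sub (f := fun z => f (e * φ z))
    (hf.comp (hφd.const_mul e) hm)
    (fun x hx y hy hxy => hφi hx hy (mul_left_cancel₀ he0 (hinj (hm hx) (hm hy) hxy))) hv
  rw [hder.deriv, norm_mul, norm_mul, hen, one_mul, Complex.norm_real,
    Real.norm_of_nonneg (by positivity), hφ0, mul_zero] at hq
  have e1 : ‖deriv f 0‖ * (4 * ‖ζ‖ / (1 + ‖ζ‖) ^ 2) =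
    4 * (‖deriv f 0‖ * ‖ζ‖ / (1 + ‖ζ‖) ^ 2) := by ring
  linarith

lemma one_add_conj_mul_ne_zero {ζ z : ℂ} (hζ : ζ ∈ ball (0 : ℂ) 1) (hz : z ∈ ball (0 : ℂ) 1) :
    1 + starRingEnd ℂ ζ * z ≠ 0 := fun h => by
  have h1 : ‖ζ‖ < 1 := by simpa using hζ
  have h2 : ‖z‖ < 1 := by simpa using hz
  have h3 : starRingEnd ℂ ζ * z = -1 := by linear_combination h
  have h4 := congrArg norm h3
  rw [norm_mul, RCLike.norm_conj, norm_neg, norm_one] at h4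
  nlinarith [norm_nonneg ζ, norm_nonneg z]

lemma norm_add_div_one_add_conj_mul_lt_one {ζ z : ℂ} (hζ : ζ ∈ ball (0 : ℂ) 1)
    (hz : z ∈ ball (0 : ℂ) 1) : ‖(z + ζ) / (1 + starRingEnd ℂ ζ * z)‖ < 1 := by
  have hsq : ∀ x ∈ ball (0 : ℂ) 1, Complex.normSq x < 1 := fun x hx => by
    have : ‖x‖ < 1 := by simpa using hx
    rw [Complex.normSq_eq_norm_sq]; nlinarith [norm_nonneg x]
  have h1 := mul_pos (sub_pos.2 (hsq ζ hζ)) (sub_pos.2 (hsq z hz))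
  rw [norm_div, div_lt_one (norm_pos_iff.2 (one_add_conj_mul_ne_zero hζ hz)),
    ← sq_lt_sq₀ (norm_nonneg _) (norm_nonneg _), ← Complex.normSq_eq_norm_sq,
    ← Complex.normSq_eq_norm_sq]
  simp only [Complex.normSq_apply] at h1 ⊢
  simp
  nlinarith

/-- The bound on the logarithmic derivative obtained from the Koebe transform of `f` at `ζ`. -/
theorem mul_norm_deriv_le {f : ℂ → ℂ} (hf : DifferentiableOn ℂ f (ball 0 1))
    (hinj : InjOn f (ball 0 1)) {ζ : ℂ} (hζ : ζ ∈ ball (0 : ℂ) 1) :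
    ‖ζ‖ * (1 - ‖ζ‖) * ‖deriv f ζ‖ ≤ (1 + ‖ζ‖) * ‖f ζ - f 0‖ := by
  have hζ1 : ‖ζ‖ < 1 := by simpa using hζ
  set T : ℂ → ℂ := fun z => (z + ζ) / (1 + starRingEnd ℂ ζ * z) with hT
  have hTne : ∀ z ∈ ball (0 : ℂ) 1, 1 + starRingEnd ℂ ζ * z ≠ 0 := fun z hz =>
    one_add_conj_mul_ne_zero hζ hz
  have hTm : MapsTo T (ball 0 1) (ball 0 1) := fun z hz =>
    mem_ball_zero_iff.2 (norm_add_div_one_add_conj_mul_lt_one hζ hz)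
  have hTd : DifferentiableOn ℂ T (ball 0 1) :=
    DifferentiableOn.div (by fun_prop) (by fun_prop) hTne
  have hnc : (1 : ℂ) - ζ * starRingEnd ℂ ζ = ((1 - ‖ζ‖ ^ 2 : ℝ) : ℂ) := by
    rw [Complex.mul_conj']; push_cast; ring
  have hpos : 0 < 1 - ‖ζ‖ ^ 2 := by nlinarith [norm_nonneg ζ]
  have hTi : InjOn T (ball 0 1) := fun x hx y hy hxy => by
    simp only [hT] at hxy
    rw [div_eq_div_iff (hTne x hx) (hTne y hy)] at hxy
    have h1 : (1 : ℂ) - ζ * starRingEnd ℂ ζ ≠ 0 := by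
      rw [hnc]; exact_mod_cast hpos.ne'
    refine mul_left_cancel₀ h1 ?_
    linear_combination hxy
  have hT0 : T 0 = ζ := by simp [hT]
  have hTζ : T (-ζ) = 0 := by simp [hT]
  have hT' : HasDerivAt T ((1 - ‖ζ‖ ^ 2 : ℝ) : ℂ) 0 := by
    rw [← hnc]
    refine (((hasDerivAt_id (0 : ℂ)).add_const ζ).div
      (((hasDerivAt_id (0 : ℂ)).const_mul (starRingEnd ℂ ζ)).const_add 1) (by simp)).congr_deriv ?_
    simp
  have hder : HasDerivAt (fun z => f (T z)) (deriv f ζ * ((1 - ‖ζ‖ ^ 2 : ℝ) : ℂ)) 0 := by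
    have h1 : HasDerivAt f (deriv f ζ) (T 0) := by
      rw [hT0]; exact (hf.differentiableAt (isOpen_ball.mem_nhds hζ)).hasDerivAt
    exact h1.comp 0 hT'
  have hlow := norm_deriv_mul_div_le_norm_sub (f := fun z => f (T z)) (hf.comp hTd hTm)
    (fun x hx y hy hxy => hTi hx hy (hinj (hTm hx) (hTm hy) hxy)) (ζ := -ζ) (by simpa using hζ)
  rw [hder.deriv, norm_mul, Complex.norm_real, Real.norm_of_nonneg hpos.le, norm_neg, hT0, hTζ,
    norm_sub_rev, div_le_iff₀ (by positivity)] at hlow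
  refine le_of_mul_le_mul_right ?_ (by positivity : 0 < 1 + ‖ζ‖)
  linear_combination hlow

/-- The upper bound of the growth theorem. -/
theorem norm_sub_le_norm_deriv_mul_div {f : ℂ → ℂ} (hf : DifferentiableOn ℂ f (ball 0 1))
    (hinj : InjOn f (ball 0 1)) {ζ : ℂ} (hζ : ζ ∈ ball (0 : ℂ) 1) :
    ‖f ζ - f 0‖ ≤ ‖deriv f 0‖ * ‖ζ‖ / (1 - ‖ζ‖) ^ 2 := by
  by_cases h0 : ζ = 0
  · simp [h0]
  have hζ1 : ‖ζ‖ < 1 := by simpa using hζ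
  have hr0 : 0 < ‖ζ‖ := norm_pos_iff.2 h0
  have hrc : (‖ζ‖ : ℂ) ≠ 0 := by exact_mod_cast hr0.ne'
  set F := dslope f 0 with hFdef
  have hF : DifferentiableOn ℂ F (ball 0 1) :=
    (Complex.differentiableOn_dslope (ball_mem_nhds 0 one_pos)).2 hf
  have hfF : ∀ z, f z - f 0 = z * F z := fun z => by
    simpa using (sub_smul_dslope f 0 z).symm
  set e : ℂ := ζ / ‖ζ‖ with he
  have hen : ‖e‖ = 1 := by
    rw [he, norm_div, Complex.norm_real, norm_norm, div_self hr0.ne']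
  have hnorm : ∀ x : ℝ, 0 ≤ x → ‖(x : ℂ) * e‖ = x := fun x hx => by
    rw [norm_mul, hen, mul_one, Complex.norm_real, Real.norm_of_nonneg hx]
  have hmem : ∀ x ∈ Icc (0 : ℝ) ‖ζ‖, (x : ℂ) * e ∈ ball (0 : ℂ) 1 := fun x hx => by
    rw [mem_ball_zero_iff, hnorm x hx.1]; exact hx.2.trans_lt hζ1
  set N : ℝ → ℝ := fun x => ‖F (x * e)‖ ^ 2 * (1 - x) ^ 4 with hN
  have hder : ∀ x ∈ Icc (0 : ℝ) ‖ζ‖, HasDerivAt N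
      (2 * inner ℝ (F (x * e)) (deriv F (x * e) * e) * (1 - x) ^ 4 -
        ‖F (x * e)‖ ^ 2 * (4 * (1 - x) ^ 3)) x := fun x hx => by
    have h1 := (hF.differentiableAt (isOpen_ball.mem_nhds (hmem x hx))).hasDerivAt
    have h2 : HasDerivAt (fun x : ℝ => (x : ℂ) * e) e x := by
      simpa using (Complex.ofRealCLM.hasDerivAt (x := x)).mul_const e
    have h3 : HasDerivAt (fun x : ℝ => F (x * e)) (deriv F (x * e) * e) x :=
      h1.comp x h2
    have h4 : HasDerivAt (fun x : ℝ => (1 - x) ^ 4) (-(4 * (1 - x) ^ 3)) x := by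
      refine (((hasDerivAt_id x).const_sub 1).pow 4).congr_deriv ?_
      simp
    refine (h3.norm_sq.mul h4).congr_deriv ?_
    ring
  have hnonpos : ∀ x ∈ Ioo (0 : ℝ) ‖ζ‖,
      2 * inner ℝ (F (x * e)) (deriv F (x * e) * e) * (1 - x) ^ 4 -
        ‖F (x * e)‖ ^ 2 * (4 * (1 - x) ^ 3) ≤ 0 := fun x hx => by
    have hxI := Ioo_subset_Icc_self hx
    have hx1 : 0 < 1 - x := by linarith [hx.2]
    set z := (x : ℂ) * e with hz
    have hzn : ‖z‖ = x := hnorm x hx.1.le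
    have hfz : deriv f z = F z + z * deriv F z := by
      have h1 := ((hasDerivAt_id z).mul
        (hF.differentiableAt (isOpen_ball.mem_nhds (hmem x hxI))).hasDerivAt).add_const (f 0)
      have h2 : HasDerivAt f (1 * F z + id z * deriv F z) z := by
        refine h1.congr_of_eventuallyEq (Eventually.of_forall fun y => ?_)
        simp only [Pi.mul_apply, id]
        linear_combination hfF y
      rw [h2.deriv, one_mul, id]
    have hb := mul_norm_deriv_le hf hinj (ζ := z) (hmem x hxI)
    rw [hfF, norm_mul z (F z), hzn] at hb
    have hb' : (1 - x) * ‖deriv f z‖ ≤ (1 + x) * ‖F z‖ := by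
      refine le_of_mul_le_mul_left ?_ hx.1
      linear_combination hb
    have hin : x * inner ℝ (F z) (deriv F z * e) = inner ℝ (F z) (deriv f z) - ‖F z‖ ^ 2 := by
      rw [← real_inner_smul_right, ← real_inner_self_eq_norm_sq, ← inner_sub_right]
      congr 1
      rw [hfz, Complex.real_smul, hz]; ring
    have hcs := real_inner_le_norm (F z) (deriv f z)
    have key : (1 - x) * inner ℝ (F z) (deriv F z * e) ≤ 2 * ‖F z‖ ^ 2 := by
      refine le_of_mul_le_mul_left ?_ hx.1
      nlinarith [mul_le_mul_of_nonneg_left hcs hx1.le,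
        mul_le_mul_of_nonneg_left hb' (norm_nonneg (F z))]
    have := mul_le_mul_of_nonneg_left key (by positivity : 0 ≤ 2 * (1 - x) ^ 3)
    linear_combination this
  have hanti : AntitoneOn N (Icc 0 ‖ζ‖) := by
    refine antitoneOn_of_deriv_nonpos (convex_Icc _ _)
      (fun x hx => (hder x hx).continuousAt.continuousWithinAt) ?_ ?_ <;>
    rw [interior_Icc]
    · exact fun x hx =>
        (hder x (Ioo_subset_Icc_self hx)).differentiableAt.differentiableWithinAt
    · exact fun x hx => (hder x (Ioo_subset_Icc_self hx)).deriv.trans_le (hnonpos x hx)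
  have hfin := hanti (left_mem_Icc.2 hr0.le) (right_mem_Icc.2 hr0.le) hr0.le
  have hζe : (‖ζ‖ : ℂ) * e = ζ := by rw [he]; field_simp
  simp only [hN, hζe, Complex.ofReal_zero, zero_mul, sub_zero, one_pow, mul_one] at hfin
  rw [hFdef, dslope_same, ← hFdef] at hfin
  have hsq : (‖F ζ‖ * (1 - ‖ζ‖) ^ 2) ^ 2 ≤ ‖deriv f 0‖ ^ 2 := by
    linear_combination hfin
  have hle := le_of_sq_le_sq hsq (norm_nonneg _)
  rw [hfF, norm_mul, le_div_iff₀ (pow_pos (sub_pos.2 hζ1) 2)]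
  linear_combination ‖ζ‖ * hle

end Koebe

/-- **Koebe growth theorem.** If `f` is holomorphic and injective on the
open unit disc with `f 0 = w` and `f' 0 = c > 0`, then for every `ζ` in the unit disc,
`c |ζ| / (1 + |ζ|)² ≤ |f ζ − w| ≤ c |ζ| / (1 − |ζ|)²`. -/
theorem cle_gasket_stmt_1
    (f : ℂ → ℂ) (hf_holo : DifferentiableOn ℂ f (ball (0 : ℂ) 1))
    (hf_inj : InjOn f (ball (0 : ℂ) 1))
    (w : ℂ) (hf0 : f 0 = w)
    (c : ℝ) (hc : 0 < c) (hf'0 : deriv f 0 = (c : ℂ)) :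
    ∀ ζ ∈ ball (0 : ℂ) 1,
      c * ‖ζ‖ / (1 + ‖ζ‖) ^ 2 ≤ ‖f ζ - w‖ ∧
      ‖f ζ - w‖ ≤ c * ‖ζ‖ / (1 - ‖ζ‖) ^ 2 := by
  intro ζ hζ
  have hnorm : ‖deriv f 0‖ = c := by rw [hf'0, Complex.norm_real, Real.norm_of_nonneg hc.le]
  rw [← hf0, ← hnorm]
  exact ⟨Koebe.norm_deriv_mul_div_le_norm_sub hf_holo hf_inj hζ,
    Koebe.norm_sub_le_norm_deriv_mul_div hf_holo hf_inj hζ⟩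
end

section
/- Let f be a holomorphic injective map on the open unit disc 𝔻 = {z ∈ ℂ : |z| < 1} with f(0) = w and f'(0) = c a positive real number. Then: (i) for every ζ ∈ 𝔻, |f(ζ) − w| ≥ c·|ζ|/4; and (ii) for every ζ ∈ 𝔻 with |ζ| ≤ 1/2, |f(ζ) − w| ≤ 4·c·|ζ|. -/
open Metric Set
open Filter Topology

/-- An injective holomorphic function has nonvanishing derivative. -/
theorem deriv_ne_zero_of_injOn_of_isOpen {f : ℂ → ℂ} {U : Set ℂ} (hU : IsOpen U)
    (hf : DifferentiableOn ℂ f U) (hinj : InjOn f U) {a : ℂ} (ha : a ∈ U) : deriv f a ≠ 0 := by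
  intro hd
  have hUa : U ∈ 𝓝 a := hU.mem_nhds ha
  have hfa : AnalyticAt ℂ f a := hf.analyticAt hUa
  have hF : AnalyticAt ℂ (fun z => f z - f a) a := hfa.sub analyticAt_const
  have hne : ¬ ∀ᶠ z in 𝓝 a, f z - f a = 0 := by
    intro h
    have h2 : ∀ᶠ z in 𝓝[≠] a, False := by
      filter_upwards [nhdsWithin_le_nhds h, nhdsWithin_le_nhds hUa, self_mem_nhdsWithin]
        with z hz hzU hza
      exact hza (hinj hzU ha (sub_eq_zero.mp hz))
    exact h2.exists.elim fun _ h => h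
  obtain ⟨n, g, hg, hg0, hfg⟩ := hF.exists_eventuallyEq_pow_smul_nonzero_iff.mpr hne
  have hn0 : n ≠ 0 := by
    rintro rfl
    have := hfg.self_of_nhds
    simp at this
    exact hg0 this.symm
  have hn1 : n ≠ 1 := by
    rintro rfl
    have h1 : HasDerivAt (fun z => (z - a) ^ 1 • g z) (g a) a := by
      have := ((hasDerivAt_id a).sub_const a).mul hg.differentiableAt.hasDerivAt
      simpa using! this
    have h2 := (h1.congr_of_eventuallyEq hfg).deriv
    rw [deriv_sub_const, hd] at h2
    exact hg0 h2.symm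
  -- a local `n`-th root of `z ↦ f z - f a`, up to a constant factor
  let h : ℂ → ℂ := fun z => (z - a) * Complex.exp (Complex.log (g z / g a) / n)
  have hnC : (n : ℂ) ≠ 0 := by exact_mod_cast hn0
  have hlog : AnalyticAt ℂ (fun z => Complex.log (g z / g a)) a :=
    (hg.div analyticAt_const hg0).clog (by simp [hg0])
  have hexp : AnalyticAt ℂ (fun z => Complex.exp (Complex.log (g z / g a) / n)) a :=
    (hlog.div analyticAt_const hnC).cexp
  have hha : AnalyticAt ℂ h a := (analyticAt_id.sub analyticAt_const).mul hexp
  have hderiv : HasDerivAt h 1 a := by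
    have := ((hasDerivAt_id a).sub_const a).mul hexp.differentiableAt.hasDerivAt
    simpa [hg0] using! this
  have hstrict : HasStrictDerivAt h 1 a := by
    have := hha.hasStrictDerivAt
    rwa [hderiv.deriv] at this
  have hmap : Filter.map h (𝓝 a) = 𝓝 0 := by
    rw [hstrict.map_nhds_eq one_ne_zero]
    simp [h]
  have hpow : ∀ᶠ z in 𝓝 a, z ∈ U ∧ f z - f a = g a * h z ^ n := by
    filter_upwards [hfg, hg.continuousAt.eventually_ne hg0, hUa] with z hz hgz hzU
    refine ⟨hzU, ?_⟩
    rw [hz, mul_pow, ← Complex.exp_nat_mul, mul_div_cancel₀ _ hnC,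
      Complex.exp_log (div_ne_zero hgz hg0), smul_eq_mul]
    field_simp
  have himg : h '' {z | z ∈ U ∧ f z - f a = g a * h z ^ n} ∈ 𝓝 (0 : ℂ) := by
    rw [← hmap]
    exact image_mem_map hpow
  obtain ⟨ω, hω⟩ : ∃ ω : ℂ, IsPrimitiveRoot ω n := ⟨_, Complex.isPrimitiveRoot_exp n hn0⟩
  have hrot : ∀ᶠ w in 𝓝 (0 : ℂ), ω * w ∈ h '' {z | z ∈ U ∧ f z - f a = g a * h z ^ n} := by
    have : Tendsto (fun w : ℂ => ω * w) (𝓝 0) (𝓝 0) := by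
      simpa using (continuous_const_mul ω).tendsto 0
    exact this himg
  have himg' : ∀ᶠ w in 𝓝 (0 : ℂ), w ∈ h '' {z | z ∈ U ∧ f z - f a = g a * h z ^ n} := himg
  obtain ⟨w, ⟨⟨x, ⟨hxU, hx⟩, hxw⟩, y, ⟨hyU, hy⟩, hyw⟩, hw0⟩ :=
    (((himg'.and hrot).filter_mono nhdsWithin_le_nhds).and
      (self_mem_nhdsWithin : {0}ᶜ ∈ 𝓝[≠] (0 : ℂ))).exists
  have hxy : x = y := by
    apply hinj hxU hyU
    rw [hxw] at hx
    rw [hyw, mul_pow, hω.pow_eq_one, one_mul, ← hx] at hy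
    exact (sub_left_inj.mp hy).symm
  have hω1 : ω ≠ 1 := hω.ne_one (by omega)
  rw [← hxy, hxw] at hyw
  apply hω1
  exact mul_right_cancel₀ hw0 (by rw [one_mul]; exact hyw.symm)

/-- A nonvanishing holomorphic function on a disc has a holomorphic logarithm. -/
theorem exists_log_of_differentiableOn_ball {g : ℂ → ℂ} {r : ℝ}
    (hg : DifferentiableOn ℂ g (ball 0 r)) (hg0 : ∀ z ∈ ball (0 : ℂ) r, g z ≠ 0) :
    ∃ L : ℂ → ℂ, L 0 = 0 ∧ (∀ z ∈ ball (0 : ℂ) r, HasDerivAt L (deriv g z / g z) z) ∧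
      ∀ z ∈ ball (0 : ℂ) r, g z = g 0 * Complex.exp (L z) := by
  have hq : DifferentiableOn ℂ (fun z => deriv g z / g z) (ball 0 r) :=
    (hg.deriv isOpen_ball).div hg hg0
  obtain ⟨L, hL0, hL⟩ := hq.isExactOn_ball.with_val_at 0 0
  refine ⟨L, hL0, hL, fun z hz => ?_⟩
  have hder : ∀ x ∈ ball (0 : ℂ) r,
      HasDerivAt (fun z => g z * Complex.exp (-L z)) 0 x := by
    intro x hx
    have h1 := (hg.differentiableAt (isOpen_ball.mem_nhds hx)).hasDerivAt
    convert! h1.mul (hL x hx).neg.cexp using 1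
    field_simp [hg0 x hx]
    ring
  have h0 : (0 : ℂ) ∈ ball (0 : ℂ) r := mem_ball_self (pos_of_mem_ball hz)
  have hconst := isOpen_ball.is_const_of_deriv_eq_zero (convex_ball (0 : ℂ) r).isPreconnected
    (fun x hx => (hder x hx).differentiableAt.differentiableWithinAt)
    (fun x hx => (hder x hx).deriv) hz h0
  simp only [hL0, neg_zero, Complex.exp_zero, mul_one] at hconst
  rw [← hconst, mul_assoc, ← Complex.exp_add]
  simp

/-- If `z ↦ z⁻¹ + b z` is injective on the punctured disc and maps the circle of radius `ρ` into
a closed convex set, then so it does with the annulus between this circle and the unit circle. -/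
theorem inv_add_mem_of_mapsTo_sphere {b : ℂ → ℂ} (hb : DifferentiableOn ℂ b (ball 0 1))
    (hinj : InjOn (fun z => z⁻¹ + b z) (ball 0 1 \ {0})) {ρ : ℝ} (hρ : 0 < ρ)
    {K : Set ℂ} (hKconv : Convex ℝ K) (hKclosed : IsClosed K)
    (hK : ∀ z ∈ sphere (0 : ℂ) ρ, z⁻¹ + b z ∈ K) {z₀ : ℂ} (hz₀ : ρ < ‖z₀‖) (hz₀' : ‖z₀‖ < 1) :
    z₀⁻¹ + b z₀ ∈ K := by
  by_contra hp
  set p := z₀⁻¹ + b z₀ with hpdef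
  obtain ⟨ℓ, u, hℓK, hℓp⟩ :=
    RCLike.geometric_hahn_banach_closed_point (𝕜 := ℂ) hKconv hKclosed hp
  have hℓ : ∀ x, ℓ x = ℓ 1 * x := fun x => by
    have := ℓ.map_smul x 1
    simpa [mul_comm] using this
  set m := ℓ 1
  have hball : closedBall (0 : ℂ) ρ ⊆ ball 0 1 := closedBall_subset_ball (hz₀.trans hz₀')
  have hD : ∀ z ∈ closedBall (0 : ℂ) ρ, 1 + z * (b z - p) ≠ 0 := by
    intro z hz h
    by_cases hz0 : z = 0
    · simp [hz0] at h
    · have h1 : z⁻¹ + b z = z₀⁻¹ + b z₀ := by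
        rw [← hpdef]
        field_simp
        linear_combination h
      have hz00 : z₀ ≠ 0 := norm_pos_iff.mp (hρ.trans hz₀)
      have := hinj ⟨hball hz, hz0⟩ ⟨by simpa using hz₀', hz00⟩ h1
      rw [this] at hz
      simp at hz
      linarith
  let q : ℂ → ℂ := fun z => m⁻¹ * (z / (1 + z * (b z - p)))
  have hbd : DifferentiableOn ℂ b (closedBall 0 ρ) := hb.mono hball
  have hqd : DifferentiableOn ℂ (fun z => Complex.exp (q z)) (closedBall 0 ρ) := by
    refine DifferentiableOn.cexp (DifferentiableOn.const_mul ?_ _)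
    exact differentiableOn_id.div
      ((differentiableOn_const 1).add (differentiableOn_id.mul (hbd.sub_const p))) hD
  have hdc : DiffContOnCl ℂ (fun z => Complex.exp (q z)) (ball 0 ρ) := by
    apply DifferentiableOn.diffContOnCl
    rwa [closure_ball _ hρ.ne']
  obtain ⟨z, hz, hmax⟩ := Complex.exists_mem_frontier_isMaxOn_norm isBounded_ball
    (nonempty_ball.mpr hρ) hdc
  rw [frontier_ball _ hρ.ne'] at hz
  have h0 := hmax (subset_closure (mem_ball_self hρ))
  have hz0 : z ≠ 0 := by
    rintro rfl
    simp at hz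
    exact hρ.ne hz
  have hq0 : q 0 = 0 := by simp [q]
  simp only [mem_ofPred_eq, Function.comp_apply, hq0, Complex.norm_exp, Complex.zero_re,
    Real.exp_le_exp] at h0
  have hq : q z = (m * (z⁻¹ + b z - p))⁻¹ := by
    have hDz := hD z (sphere_subset_closedBall hz)
    have : 1 + z * (b z - p) = z * (z⁻¹ + b z - p) := by field_simp; ring
    simp only [q]
    rw [this] at hDz ⊢
    have := right_ne_zero_of_mul hDz
    rw [mul_inv]
    congr 1
    field_simp
  have hre : (m * (z⁻¹ + b z - p)).re < 0 := by
    have h1 := (hℓK _ (hK z hz)).trans hℓp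
    rw [hℓ, hℓ p] at h1
    rw [mul_sub, Complex.sub_re]
    simpa using h1
  rw [hq, Complex.inv_re] at h0
  have hpos : 0 < Complex.normSq (m * (z⁻¹ + b z - p)) :=
    Complex.normSq_pos.mpr (fun h => by simp [h] at hre)
  exact absurd (div_neg_of_neg_of_pos hre hpos) (not_lt.mpr h0)

open MeasureTheory in
open scoped Real in
/-- A lower bound for the mean square of `-z⁻² + b z` over a circle. -/
theorem two_pi_mul_le_integral_norm_sq_circleMap {b : ℂ → ℂ}
    (hb : DifferentiableOn ℂ b (ball 0 1)) {r : ℝ} (hr : 0 < r) (hr1 : r < 1) :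
    2 * π * (r⁻¹ ^ 4 + ‖b 0‖ ^ 2) ≤
      ∫ θ in -π..π, ‖-(circleMap 0 r θ ^ 2)⁻¹ + b (circleMap 0 r θ)‖ ^ 2 := by
  set β := b 0 with hβ
  let H : ℂ → ℂ := fun z =>
    (r⁻¹ ^ 4 : ℝ) * (1 - 2 * (z ^ 2 * b z)) + 2 * (starRingEnd ℂ β * b z) - (‖β‖ ^ 2 : ℝ)
  have hHd : DifferentiableOn ℂ H (ball 0 1) := by
    simp only [H]
    fun_prop
  have hball : closedBall (0 : ℂ) r ⊆ ball 0 1 := closedBall_subset_ball hr1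
  have hcm : ∀ θ, circleMap 0 r θ ∈ ball (0 : ℂ) 1 := fun θ =>
    hball (circleMap_mem_closedBall 0 hr.le θ)
  have hmean : ∫ θ in 0..2 * π, H (circleMap 0 r θ) = (2 * π * (r⁻¹ ^ 4 + ‖β‖ ^ 2) : ℝ) := by
    have hdc : DiffContOnCl ℂ H (ball 0 |r|) := by
      apply DifferentiableOn.diffContOnCl
      rw [abs_of_pos hr, closure_ball _ hr.ne']
      exact hHd.mono hball
    have h := hdc.circleAverage
    rw [Real.circleAverage_def, inv_smul_eq_iff₀ (by positivity)] at h
    rw [h]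
    have hββ : starRingEnd ℂ β * β = (‖β‖ ^ 2 : ℝ) := by
      rw [mul_comm, Complex.mul_conj, Complex.normSq_eq_norm_sq]
    simp only [H, ← hβ, hββ, Complex.real_smul]
    push_cast
    ring
  have hcont : Continuous fun θ => H (circleMap 0 r θ) :=
    hHd.continuousOn.comp_continuous (continuous_circleMap 0 r) hcm
  have hbcont : Continuous fun θ => b (circleMap 0 r θ) :=
    hb.continuousOn.comp_continuous (continuous_circleMap 0 r) hcm
  have hcont' : Continuous fun θ => ‖-(circleMap 0 r θ ^ 2)⁻¹ + b (circleMap 0 r θ)‖ ^ 2 := by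
    have : Continuous fun θ => (circleMap 0 r θ ^ 2)⁻¹ :=
      ((continuous_circleMap 0 r).pow 2).inv₀ fun θ =>
        pow_ne_zero 2 (circleMap_ne_center hr.ne')
    exact ((this.neg.add hbcont).norm).pow 2
  have hper : ∫ θ in -π..π, ‖-(circleMap 0 r θ ^ 2)⁻¹ + b (circleMap 0 r θ)‖ ^ 2 =
      ∫ θ in 0..2 * π, ‖-(circleMap 0 r θ ^ 2)⁻¹ + b (circleMap 0 r θ)‖ ^ 2 := by
    have hp : Function.Periodic
        (fun θ => ‖-(circleMap 0 r θ ^ 2)⁻¹ + b (circleMap 0 r θ)‖ ^ 2) (2 * π) := fun θ => by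
      simp only [periodic_circleMap 0 r θ]
    have := hp.intervalIntegral_add_eq (-π) 0
    rwa [zero_add, show -π + 2 * π = π by ring] at this
  rw [hper]
  have hre : ∫ θ in 0..2 * π, (H (circleMap 0 r θ)).re = 2 * π * (r⁻¹ ^ 4 + ‖β‖ ^ 2) := by
    have := intervalIntegral.intervalIntegral_re (𝕜 := ℂ)
      (hcont.intervalIntegrable (μ := volume) 0 (2 * π))
    rw [hmean] at this
    simpa only [RCLike.re_to_complex, Complex.ofReal_re] using this
  rw [← hre]
  apply intervalIntegral.integral_mono_on (by positivity)
    ((Complex.continuous_re.comp hcont).intervalIntegrable _ _) (hcont'.intervalIntegrable _ _)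
  intro θ _
  set z := circleMap 0 r θ with hz
  have hz0 : z ≠ 0 := circleMap_ne_center hr.ne'
  have hzr : ‖z‖ = r := by simp [hz, abs_of_pos hr]
  have hw : (r⁻¹ ^ 4 : ℝ) * z ^ 2 = starRingEnd ℂ ((z ^ 2)⁻¹) := by
    have h1 : starRingEnd ℂ (z ^ 2)⁻¹ * (z ^ 2)⁻¹ = (r⁻¹ ^ 4 : ℝ) := by
      rw [mul_comm, Complex.mul_conj, Complex.normSq_eq_norm_sq, norm_inv, norm_pow, hzr]
      congr 1
      rw [inv_pow, inv_pow, ← pow_mul]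
    rw [← h1, mul_assoc, inv_mul_cancel₀ (pow_ne_zero 2 hz0), mul_one]
  have hwn : ‖(z ^ 2)⁻¹‖ ^ 2 = r⁻¹ ^ 4 := by
    rw [norm_inv, norm_pow, hzr, inv_pow, inv_pow, ← pow_mul]
  have hHz : H z = (r⁻¹ ^ 4 : ℝ) - 2 * (starRingEnd ℂ ((z ^ 2)⁻¹) * b z)
      + 2 * (starRingEnd ℂ β * b z) - (‖β‖ ^ 2 : ℝ) := by
    rw [← hw]; simp only [H]; ring
  change (H z).re ≤ _
  rw [hHz, ← hwn]
  generalize (z ^ 2)⁻¹ = w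
  generalize b z = v
  simp only [← Complex.normSq_eq_norm_sq, Complex.normSq_apply, Complex.add_re, Complex.sub_re,
    Complex.mul_re, Complex.ofReal_re, Complex.add_im, Complex.neg_re, Complex.neg_im,
    Complex.conj_re, Complex.conj_im, Complex.re_ofNat, Complex.im_ofNat]
  nlinarith [sq_nonneg (v.re - β.re), sq_nonneg (v.im - β.im)]

open MeasureTheory in
open scoped Real in
/-- A lower bound for the area of the image of an annulus under an injective `z ↦ z⁻¹ + b z`. -/
theorem le_volume_image_annulus {b : ℂ → ℂ} (hb : DifferentiableOn ℂ b (ball 0 1))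
    (hinj : InjOn (fun z => z⁻¹ + b z) (ball 0 1 \ {0})) {ρ : ℝ} (hρ : 0 < ρ) (hρ1 : ρ < 1) :
    ENNReal.ofReal (π * (ρ⁻¹ ^ 2 - 1 + ‖deriv b 0‖ ^ 2 * (1 - ρ ^ 2))) ≤
      volume ((fun z => z⁻¹ + b z) '' {z : ℂ | ρ < ‖z‖ ∧ ‖z‖ < 1}) := by
  set A : Set ℂ := {z : ℂ | ρ < ‖z‖ ∧ ‖z‖ < 1} with hA
  set β := deriv b 0 with hβ
  let D : ℂ → ℂ := fun z => -(z ^ 2)⁻¹ + deriv b z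
  have hAo : IsOpen A :=
    (isOpen_lt continuous_const continuous_norm).inter (isOpen_lt continuous_norm continuous_const)
  have hAsub : A ⊆ ball 0 1 \ {0} := fun z hz =>
    ⟨by simpa using hz.2, norm_pos_iff.mp (hρ.trans hz.1)⟩
  have hD : Measurable D := by
    have := measurable_deriv b
    fun_prop
  have hder : ∀ z ∈ A, HasDerivAt (fun z => z⁻¹ + b z) (D z) z := fun z hz =>
    (hasDerivAt_inv (hAsub hz).2).add
      (hb.differentiableAt (isOpen_ball.mem_nhds (hAsub hz).1)).hasDerivAt
  have harea := lintegral_abs_det_fderiv_eq_addHaar_image volume hAo.measurableSet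
    (fun z hz => ((hder z hz).hasFDerivAt.restrictScalars ℝ).hasFDerivWithinAt)
    (hinj.mono hAsub)
  have hdet : ∀ z, |((ContinuousLinearMap.toSpanSingleton ℂ (D z)).restrictScalars ℝ).det| =
      ‖D z‖ ^ 2 := fun z => by
    simp [ContinuousLinearMap.det, LinearMap.det_restrictScalars, Algebra.norm_complex_eq,
      Complex.normSq_eq_norm_sq]
  simp only [hdet] at harea
  rw [← harea, ← lintegral_indicator hAo.measurableSet, ← Complex.lintegral_comp_polarCoord_symm,
    polarCoord_target, Measure.volume_eq_prod]
  have hmeas : Measurable (A.indicator fun z => ENNReal.ofReal (‖D z‖ ^ 2)) :=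
    Measurable.indicator (by fun_prop) hAo.measurableSet
  have hpm : Measurable fun p : ℝ × ℝ => Complex.polarCoord.symm p := by
    simp only [Complex.polarCoord_symm_apply]
    fun_prop
  have hjm : Measurable fun p : ℝ × ℝ => ENNReal.ofReal p.1 •
      A.indicator (fun z => ENNReal.ofReal (‖D z‖ ^ 2)) (Complex.polarCoord.symm p) :=
    Measurable.mul (by fun_prop) (hmeas.comp hpm)
  rw [setLIntegral_prod _ hjm.aemeasurable]
  have hpolar : ∀ r θ : ℝ, Complex.polarCoord.symm (r, θ) = circleMap 0 r θ := fun r θ => by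
    rw [Complex.polarCoord_symm_apply, circleMap, Complex.exp_mul_I]
    simp
  have hradial : ∀ r ∈ Ioo ρ 1, ENNReal.ofReal (2 * π * (r⁻¹ ^ 3 + ‖β‖ ^ 2 * r)) ≤
      ∫⁻ θ in Ioo (-π) π, ENNReal.ofReal r •
        A.indicator (fun z => ENNReal.ofReal (‖D z‖ ^ 2)) (Complex.polarCoord.symm (r, θ)) := by
    rintro r ⟨hr, hr1⟩
    have hr0 : 0 < r := hρ.trans hr
    have hmem : ∀ θ, circleMap 0 r θ ∈ A := fun θ => by simp [hA, abs_of_pos hr0, hr, hr1]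
    have hcont : Continuous fun θ => ‖D (circleMap 0 r θ)‖ ^ 2 := by
      have h1 : Continuous fun θ => (circleMap 0 r θ ^ 2)⁻¹ :=
        ((continuous_circleMap 0 r).pow 2).inv₀ fun θ =>
          pow_ne_zero 2 (circleMap_ne_center hr0.ne')
      have h2 : Continuous fun θ => deriv b (circleMap 0 r θ) :=
        (hb.deriv isOpen_ball).continuousOn.comp_continuous (continuous_circleMap 0 r)
          fun θ => (hAsub (hmem θ)).1
      exact ((h1.neg.add h2).norm).pow 2
    simp only [hpolar, indicator_of_mem (hmem _), smul_eq_mul]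
    rw [lintegral_const_mul _ hcont.measurable.ennreal_ofReal,
      ← ofReal_integral_eq_lintegral_ofReal
        ((hcont.integrableOn_Icc (a := -π) (b := π)).mono_set Ioo_subset_Icc_self)
        (ae_of_all _ fun _ => by positivity), ← ENNReal.ofReal_mul hr0.le,
      ← integral_Ioc_eq_integral_Ioo,
      ← intervalIntegral.integral_of_le (by linarith [Real.pi_pos])]
    apply ENNReal.ofReal_le_ofReal
    have := mul_le_mul_of_nonneg_left
      (two_pi_mul_le_integral_norm_sq_circleMap (hb.deriv isOpen_ball) hr0 hr1) hr0.le
    refine le_trans (le_of_eq ?_) this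
    rw [hβ]
    field_simp
  refine le_trans ?_ (lintegral_mono_set (s := Ioo ρ 1) fun r hr => hρ.trans hr.1)
  refine le_trans ?_ (setLIntegral_mono' measurableSet_Ioo hradial)
  have hcontOn : ContinuousOn (fun r : ℝ => 2 * π * (r⁻¹ ^ 3 + ‖β‖ ^ 2 * r)) (Icc ρ 1) := by
    have : ContinuousOn (fun r : ℝ => r⁻¹) (Icc ρ 1) :=
      continuousOn_id.inv₀ fun r hr => (hρ.trans_le hr.1).ne'
    fun_prop
  have hint : IntegrableOn (fun r : ℝ => 2 * π * (r⁻¹ ^ 3 + ‖β‖ ^ 2 * r)) (Icc ρ 1) :=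
    hcontOn.integrableOn_Icc
  rw [← ofReal_integral_eq_lintegral_ofReal (hint.mono_set Ioo_subset_Icc_self)
    ((ae_restrict_mem measurableSet_Ioo).mono fun r hr => by
      have : 0 < r := hρ.trans hr.1
      simp only [Pi.zero_apply]
      positivity),
    ← integral_Ioc_eq_integral_Ioo, ← intervalIntegral.integral_of_le hρ1.le]
  apply ENNReal.ofReal_le_ofReal
  have hprim : ∀ r ∈ uIcc ρ 1, HasDerivAt (fun r : ℝ => π * (-(r⁻¹ ^ 2) + ‖β‖ ^ 2 * r ^ 2))
      (2 * π * (r⁻¹ ^ 3 + ‖β‖ ^ 2 * r)) r := by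
    intro r hr
    rw [uIcc_of_le hρ1.le] at hr
    have hr0 : r ≠ 0 := (hρ.trans_le hr.1).ne'
    convert! ((((hasDerivAt_inv hr0).pow 2).neg).add
      (((hasDerivAt_id r).pow 2).const_mul (‖β‖ ^ 2))).const_mul π using 1
    simp
    field_simp
  rw [intervalIntegral.integral_eq_sub_of_hasDerivAt hprim
    (by rw [intervalIntegrable_iff_integrableOn_Icc_of_le hρ1.le]; exact hint)]
  apply le_of_eq
  simp
  ring

/-- For `‖a‖ ≤ 1 / 2` the real-linear equation `v + a * conj v = e` is solvable, with a bound. -/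
theorem exists_add_mul_conj_eq {a : ℂ} (ha : ‖a‖ ≤ 1 / 2) (e : ℂ) :
    ∃ v : ℂ, v + a * starRingEnd ℂ v = e ∧ ‖v‖ ≤ 2 * ‖e‖ := by
  have hlt : ‖a‖ ^ 2 < 1 := by nlinarith [norm_nonneg a]
  have hne : (1 - (‖a‖ ^ 2 : ℝ) : ℂ) ≠ 0 := by
    rw [← Complex.ofReal_one, ← Complex.ofReal_sub]
    exact_mod_cast (sub_pos.mpr hlt).ne'
  have hsolve : (e - a * starRingEnd ℂ e) / (1 - (‖a‖ ^ 2 : ℝ)) +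
      a * starRingEnd ℂ ((e - a * starRingEnd ℂ e) / (1 - (‖a‖ ^ 2 : ℝ))) = e := by
    simp only [map_div₀, map_sub, map_mul, map_one, Complex.conj_conj, Complex.conj_ofReal]
    rw [← mul_div_assoc, ← add_div, div_eq_iff hne, ← Complex.normSq_eq_norm_sq,
      ← Complex.mul_conj]
    ring
  refine ⟨_, hsolve, ?_⟩
  generalize (e - a * starRingEnd ℂ e) / (1 - (‖a‖ ^ 2 : ℝ)) = v at hsolve
  have h1 : ‖v‖ ≤ ‖e‖ + ‖a‖ * ‖v‖ := by
    have := norm_sub_le e (a * starRingEnd ℂ v)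
    rwa [← hsolve, add_sub_cancel_right, hsolve, norm_mul, RCLike.norm_conj] at this
  nlinarith [norm_nonneg v]

/-- The determinant of the real-linear map `u ↦ u + a * conj u`. -/
theorem det_id_add_smul_conj (a : ℂ) :
    LinearMap.det ((ContinuousLinearMap.id ℝ ℂ + a • (Complex.conjCLE : ℂ →L[ℝ] ℂ) :
      ℂ →L[ℝ] ℂ) : ℂ →ₗ[ℝ] ℂ) = 1 - ‖a‖ ^ 2 := by
  rw [← LinearMap.det_toMatrix Complex.basisOneI, Matrix.det_fin_two]
  simp [LinearMap.toMatrix_apply, ← Complex.normSq_eq_norm_sq, Complex.normSq_apply]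
  ring

open MeasureTheory in
open scoped Real in
/-- **Area theorem**, for the first coefficient. -/
theorem norm_deriv_le_one_of_injOn_inv_add {b : ℂ → ℂ} (hb : DifferentiableOn ℂ b (ball 0 1))
    (hinj : InjOn (fun z => z⁻¹ + b z) (ball 0 1 \ {0})) : ‖deriv b 0‖ ≤ 1 := by
  set β := deriv b 0 with hβ
  have hb0 : HasDerivAt b β 0 :=
    (hb.differentiableAt (isOpen_ball.mem_nhds (mem_ball_self one_pos))).hasDerivAt
  have key : ∀ ε : ℝ, 0 < ε → ∀ᶠ ρ in 𝓝[>] (0 : ℝ),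
      ‖β‖ ^ 2 * (1 - ρ ^ 2) ≤ 1 + 4 * ε + 4 * ε ^ 2 * ρ ^ 2 := by
    intro ε hε
    have hlin := (hasDerivAt_iff_isLittleO.mp hb0).bound hε
    obtain ⟨δ, hδ, hδb⟩ := Metric.eventually_nhds_iff.mp hlin
    have hsmall : ∀ᶠ ρ in 𝓝 (0 : ℝ), ‖β‖ * ρ ^ 2 < 1 / 2 := by
      have : Tendsto (fun ρ : ℝ => ‖β‖ * ρ ^ 2) (𝓝 0) (𝓝 0) := by
        have : Continuous fun ρ : ℝ => ‖β‖ * ρ ^ 2 := by fun_prop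
        simpa using this.tendsto 0
      exact this.eventually_lt_const (by norm_num)
    filter_upwards [self_mem_nhdsWithin, hsmall.filter_mono nhdsWithin_le_nhds,
      (eventually_lt_nhds hδ).filter_mono nhdsWithin_le_nhds,
      (eventually_lt_nhds one_pos).filter_mono nhdsWithin_le_nhds] with ρ hρ hβρ hρδ hρ1
    rw [mem_Ioi] at hρ
    set a : ℂ := β * (ρ ^ 2 : ℝ) with ha
    have hna : ‖a‖ ≤ 1 / 2 := by
      rw [ha, norm_mul, Complex.norm_real, Real.norm_of_nonneg (by positivity)]
      exact hβρ.le
    let T : ℂ →L[ℝ] ℂ := ContinuousLinearMap.id ℝ ℂ + a • (Complex.conjCLE : ℂ →L[ℝ] ℂ)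
    have hT : ∀ u, T u = u + a * starRingEnd ℂ u := fun u => by simp [T]
    set R := ρ⁻¹ + 2 * (ε * ρ) with hR
    have hRpos : 0 < R := by positivity
    set K : Set ℂ := (fun x => b 0 + x) '' (T '' closedBall 0 R) with hK
    have hKconv : Convex ℝ K :=
      ((convex_closedBall (0 : ℂ) R).linear_image (T : ℂ →ₗ[ℝ] ℂ)).translate (b 0)
    have hKclosed : IsClosed K :=
      (((isCompact_closedBall (0 : ℂ) R).image T.continuous).image
        (continuous_const_add _)).isClosed
    have hsphere : ∀ z ∈ sphere (0 : ℂ) ρ, z⁻¹ + b z ∈ K := by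
      intro z hz
      have hzρ : ‖z‖ = ρ := by simpa using hz
      have hz0 : z ≠ 0 := norm_pos_iff.mp (hzρ ▸ hρ)
      have he := hδb (show dist z 0 < δ by simpa [hzρ] using hρδ)
      simp only [sub_zero, smul_eq_mul, hzρ] at he
      obtain ⟨v, hv, hvn⟩ := exists_add_mul_conj_eq hna (b z - b 0 - z * β)
      have hconj : a * starRingEnd ℂ z⁻¹ = z * β := by
        have : ((ρ ^ 2 : ℝ) : ℂ) = z * starRingEnd ℂ z := by
          rw [Complex.mul_conj, Complex.normSq_eq_norm_sq, hzρ]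
        have hz0' : starRingEnd ℂ z ≠ 0 := by simpa using hz0
        rw [ha, this, map_inv₀]
        field_simp
      refine ⟨T (z⁻¹ + v), ⟨z⁻¹ + v, ?_, rfl⟩, ?_⟩
      · rw [mem_closedBall_zero_iff]
        calc ‖z⁻¹ + v‖ ≤ ‖z⁻¹‖ + ‖v‖ := norm_add_le _ _
          _ ≤ ρ⁻¹ + 2 * (ε * ρ) := by
            rw [norm_inv, hzρ]
            linarith
      · simp only [hT, map_add, mul_add]
        rw [hconj]
        linear_combination hv
    have hsub : (fun z => z⁻¹ + b z) '' {z : ℂ | ρ < ‖z‖ ∧ ‖z‖ < 1} ⊆ K := by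
      rintro _ ⟨z, hz, rfl⟩
      exact inv_add_mem_of_mapsTo_sphere hb hinj hρ hKconv hKclosed hsphere hz.1 hz.2
    have hvol : volume K ≤ ENNReal.ofReal (π * R ^ 2) := by
      rw [hK, image_add_left, measure_preimage_add, Measure.addHaar_image_continuousLinearMap,
        det_id_add_smul_conj, Complex.volume_closedBall, ← ENNReal.ofReal_pow hRpos.le]
      have h1 : |1 - ‖a‖ ^ 2| ≤ 1 := by
        rw [abs_le]
        constructor <;> nlinarith [norm_nonneg a]
      calc ENNReal.ofReal |1 - ‖a‖ ^ 2| * (ENNReal.ofReal (R ^ 2) * NNReal.pi)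
          ≤ 1 * (ENNReal.ofReal (R ^ 2) * NNReal.pi) := by
            gcongr
            exact ENNReal.ofReal_le_one.mpr h1
        _ = ENNReal.ofReal (π * R ^ 2) := by
            rw [one_mul, mul_comm, ENNReal.ofReal_mul Real.pi_pos.le,
              ← NNReal.coe_real_pi, ENNReal.ofReal_coe_nnreal]
    have hfin := (le_volume_image_annulus hb hinj hρ hρ1).trans ((measure_mono hsub).trans hvol)
    rw [ENNReal.ofReal_le_ofReal_iff (by positivity), mul_le_mul_iff_right₀ Real.pi_pos] at hfin
    have hRsq : R ^ 2 = ρ⁻¹ ^ 2 + 4 * ε + 4 * ε ^ 2 * ρ ^ 2 := by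
      rw [hR]
      field_simp
      ring
    linarith
  have h2 : ∀ ε : ℝ, 0 < ε → ‖β‖ ^ 2 ≤ 1 + 4 * ε := by
    intro ε hε
    have hl : Tendsto (fun ρ : ℝ => ‖β‖ ^ 2 * (1 - ρ ^ 2)) (𝓝[>] 0) (𝓝 (‖β‖ ^ 2)) := by
      have : Continuous fun ρ : ℝ => ‖β‖ ^ 2 * (1 - ρ ^ 2) := by fun_prop
      simpa using (this.tendsto 0).mono_left nhdsWithin_le_nhds
    have hr : Tendsto (fun ρ : ℝ => 1 + 4 * ε + 4 * ε ^ 2 * ρ ^ 2) (𝓝[>] 0)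
        (𝓝 (1 + 4 * ε)) := by
      have : Continuous fun ρ : ℝ => 1 + 4 * ε + 4 * ε ^ 2 * ρ ^ 2 := by fun_prop
      simpa using (this.tendsto 0).mono_left nhdsWithin_le_nhds
    exact le_of_tendsto_of_tendsto hl hr (key ε hε)
  have h3 : ‖β‖ ^ 2 ≤ 1 := le_of_forall_pos_le_add fun ε hε => by
    have := h2 (ε / 4) (by positivity)
    linarith
  nlinarith [norm_nonneg β]

/-- **Bieberbach's inequality** for the second coefficient of a univalent function. -/
theorem norm_deriv_deriv_zero_le_of_injOn {f : ℂ → ℂ} (hf : DifferentiableOn ℂ f (ball 0 1))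
    (hinj : InjOn f (ball 0 1)) : ‖deriv (deriv f) 0‖ ≤ 4 * ‖deriv f 0‖ := by
  have h0 : (0 : ℂ) ∈ ball (0 : ℂ) 1 := mem_ball_self one_pos
  have hnhds : ball (0 : ℂ) 1 ∈ 𝓝 0 := isOpen_ball.mem_nhds h0
  set p := dslope f 0 with hp
  have hpd : DifferentiableOn ℂ p (ball 0 1) := (Complex.differentiableOn_dslope hnhds).mpr hf
  have hp0 : p 0 = deriv f 0 := dslope_same f 0
  have hfp : ∀ z, f z - f 0 = z * p z := fun z => by
    have := sub_smul_dslope f 0 z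
    simpa using this.symm
  have hp0' : p 0 ≠ 0 := hp0 ▸ deriv_ne_zero_of_injOn_of_isOpen isOpen_ball hf hinj h0
  have hpne : ∀ z ∈ ball (0 : ℂ) 1, p z ≠ 0 := by
    intro z hz h
    by_cases hz0 : z = 0
    · exact hp0' (hz0 ▸ h)
    · have := hfp z
      rw [h, mul_zero, sub_eq_zero] at this
      exact hz0 (hinj hz h0 this)
  obtain ⟨L, hL0, hL, hLp⟩ := exists_log_of_differentiableOn_ball hpd hpne
  let q : ℂ → ℂ := fun z => Complex.exp (-L z / 2)
  have hqder : ∀ z ∈ ball (0 : ℂ) 1, HasDerivAt q (q z * (-(deriv p z / p z) / 2)) z :=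
    fun z hz => ((hL z hz).neg.div_const 2).cexp
  have hqd : DifferentiableOn ℂ q (ball 0 1) := fun z hz =>
    (hqder z hz).differentiableAt.differentiableWithinAt
  have hq0 : q 0 = 1 := by simp [q, hL0]
  set k := dslope q 0 with hk
  have hkd : DifferentiableOn ℂ k (ball 0 1) := (Complex.differentiableOn_dslope hnhds).mpr hqd
  have hqk : ∀ z, q z = 1 + z * k z := fun z => by
    have := sub_smul_dslope q 0 z
    simp only [sub_zero, smul_eq_mul, hq0] at this
    rw [hk, this]
    ring
  have hsq : ∀ z ∈ ball (0 : ℂ) 1, z ^ 2 ∈ ball (0 : ℂ) 1 := fun z hz => by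
    rw [mem_ball_zero_iff] at hz ⊢
    rw [norm_pow]
    exact pow_lt_one₀ (norm_nonneg z) hz two_ne_zero
  let b : ℂ → ℂ := fun z => z * k (z ^ 2)
  have hksq : DifferentiableOn ℂ (fun z => k (z ^ 2)) (ball 0 1) :=
    hkd.comp (differentiableOn_id.pow 2) hsq
  have hbd : DifferentiableOn ℂ b (ball 0 1) := differentiableOn_id.mul hksq
  have hgq : ∀ z, z ≠ 0 → z⁻¹ + b z = z⁻¹ * q (z ^ 2) := fun z hz => by
    simp only [b, hqk]
    field_simp
  have hgsq : ∀ z ∈ ball (0 : ℂ) 1, z ≠ 0 →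
      (z⁻¹ + b z) ^ 2 * (f (z ^ 2) - f 0) = p 0 := by
    intro z hz hz0
    have hqq : q (z ^ 2) ^ 2 = Complex.exp (-L (z ^ 2)) := by
      simp only [q]
      rw [← Complex.exp_nat_mul]
      congr 1
      push_cast
      ring
    rw [hgq z hz0, mul_pow, hqq, hfp, hLp _ (hsq z hz), Complex.exp_neg]
    have := Complex.exp_ne_zero (L (z ^ 2))
    field_simp
  have hginj : InjOn (fun z => z⁻¹ + b z) (ball 0 1 \ {0}) := by
    rintro x ⟨hx, hx0⟩ y ⟨hy, hy0⟩ hxy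
    simp only at hxy
    have hx1 := hgsq x hx hx0
    have hy1 := hgsq y hy hy0
    have hgy : y⁻¹ + b y ≠ 0 := fun h => by
      rw [h] at hy1
      simp at hy1
      exact hp0' hy1.symm
    rw [hxy, ← hy1] at hx1
    have hf2 := hinj (hsq x hx) (hsq y hy)
      (sub_left_inj.mp (mul_left_cancel₀ (pow_ne_zero 2 hgy) hx1))
    rcases sq_eq_sq_iff_eq_or_eq_neg.mp hf2 with h | h
    · exact h
    · exfalso
      apply hgy
      rw [h] at hxy
      simp only [b, inv_neg, neg_mul, even_two, Even.neg_pow] at hxy ⊢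
      linear_combination (-1 / 2 : ℂ) * hxy
  have hb0 : deriv b 0 = -(deriv p 0 / p 0) / 2 := by
    have h1 : HasDerivAt b (k 0) 0 := by
      have := (hasDerivAt_id (0 : ℂ)).mul (hksq.differentiableAt hnhds).hasDerivAt
      simpa using! this
    rw [h1.deriv, hk, dslope_same, (hqder 0 h0).deriv, hq0, one_mul]
  have harea := norm_deriv_le_one_of_injOn_inv_add hbd hginj
  rw [hb0, norm_div, norm_neg, norm_div, div_div,
    div_le_one (mul_pos (norm_pos_iff.mpr hp0') (by simp))] at harea
  have hf' : deriv f =ᶠ[𝓝 0] fun z => p z + z * deriv p z := by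
    filter_upwards [hnhds] with z hz
    have h1 : HasDerivAt (fun z => f 0 + z * p z) (1 * p z + z * deriv p z) z :=
      ((hasDerivAt_id z).mul
        (hpd.differentiableAt (isOpen_ball.mem_nhds hz)).hasDerivAt).const_add (f 0)
    have h2 : (fun z => f 0 + z * p z) = f := funext fun z => by rw [← hfp]; ring
    rw [h2, one_mul] at h1
    exact h1.deriv
  have hf'' : deriv (deriv f) 0 = 2 * deriv p 0 := by
    rw [hf'.deriv_eq]
    have h1 := (hpd.differentiableAt hnhds).hasDerivAt.add ((hasDerivAt_id (0 : ℂ)).mul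
      ((hpd.deriv isOpen_ball).differentiableAt hnhds).hasDerivAt)
    have h2 := h1.deriv
    simp only [id, one_mul, zero_mul, add_zero] at h2
    rw [two_mul]
    exact h2
  rw [hf'', ← hp0, norm_mul]
  simp only [Complex.norm_ofNat] at harea ⊢
  linarith

/-- **Koebe's one-quarter theorem**: an omitted value of a univalent function on the unit disc
has distance at least `‖deriv f 0‖ / 4` from `f 0`. -/
theorem norm_deriv_zero_le_of_notMem_image {f : ℂ → ℂ} (hf : DifferentiableOn ℂ f (ball 0 1))
    (hinj : InjOn f (ball 0 1)) {v : ℂ} (hv : v ∉ f '' ball 0 1) :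
    ‖deriv f 0‖ ≤ 4 * ‖f 0 - v‖ := by
  have h0 : (0 : ℂ) ∈ ball (0 : ℂ) 1 := mem_ball_self one_pos
  have hne : ∀ z ∈ ball (0 : ℂ) 1, v - f z ≠ 0 := fun z hz h =>
    hv ⟨z, hz, (sub_eq_zero.mp h).symm⟩
  have hfd : ∀ z ∈ ball (0 : ℂ) 1, HasDerivAt f (deriv f z) z := fun z hz =>
    (hf.differentiableAt (isOpen_ball.mem_nhds hz)).hasDerivAt
  have hG : ∀ z ∈ ball (0 : ℂ) 1,
      HasDerivAt (fun z => (v - f z)⁻¹) (deriv f z / (v - f z) ^ 2) z := fun z hz => by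
    simpa using ((hfd z hz).const_sub v).fun_inv (hne z hz)
  have hGinj : InjOn (fun z => (v - f z)⁻¹) (ball 0 1) := fun x hx y hy hxy =>
    hinj hx hy (sub_right_injective (inv_injective hxy))
  have hG'' : HasDerivAt (deriv fun z => (v - f z)⁻¹)
      ((deriv (deriv f) 0 + 2 * deriv f 0 ^ 2 / (v - f 0)) / (v - f 0) ^ 2) 0 := by
    have h1 := (((hf.deriv isOpen_ball).differentiableAt
      (isOpen_ball.mem_nhds h0)).hasDerivAt.fun_div (((hfd 0 h0).const_sub v).fun_pow 2)
      (pow_ne_zero 2 (hne 0 h0)))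
    have h2 : (deriv fun z => (v - f z)⁻¹) =ᶠ[𝓝 0] fun z => deriv f z / (v - f z) ^ 2 := by
      filter_upwards [isOpen_ball.mem_nhds h0] with z hz using (hG z hz).deriv
    refine HasDerivAt.congr_of_eventuallyEq ?_ h2
    convert! h1 using 1
    have := hne 0 h0
    field_simp
    simp
    ring
  have hB := norm_deriv_deriv_zero_le_of_injOn hf hinj
  have hBG := norm_deriv_deriv_zero_le_of_injOn
    (fun z hz => (hG z hz).differentiableAt.differentiableWithinAt) hGinj
  have hpos : 0 < ‖v - f 0‖ := norm_pos_iff.mpr (hne 0 h0)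
  have hpos' : 0 < ‖deriv f 0‖ :=
    norm_pos_iff.mpr (deriv_ne_zero_of_injOn_of_isOpen isOpen_ball hf hinj h0)
  rw [hG''.deriv, (hG 0 h0).deriv, norm_div, norm_div, ← mul_div_assoc,
    div_le_div_iff_of_pos_right (norm_pos_iff.mpr (pow_ne_zero 2 (hne 0 h0)))] at hBG
  have hsub := norm_sub_le (deriv (deriv f) 0 + 2 * deriv f 0 ^ 2 / (v - f 0))
    (deriv (deriv f) 0)
  rw [add_sub_cancel_left, norm_div, norm_mul, norm_pow, Complex.norm_ofNat] at hsub
  have h3 : 2 * ‖deriv f 0‖ ^ 2 / ‖v - f 0‖ ≤ 8 * ‖deriv f 0‖ := by linarith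
  rw [div_le_iff₀ hpos] at h3
  rw [norm_sub_rev]
  nlinarith

/-- The lower bound following from the one-quarter theorem. -/
theorem norm_deriv_zero_mul_norm_le_of_injOn {f : ℂ → ℂ}
    (hf : DifferentiableOn ℂ f (ball 0 1)) (hinj : InjOn f (ball 0 1)) {ζ : ℂ}
    (hζ : ζ ∈ ball (0 : ℂ) 1) : ‖deriv f 0‖ * ‖ζ‖ ≤ 4 * ‖f ζ - f 0‖ := by
  rcases eq_or_ne ζ 0 with rfl | hζ0
  · simp
  have hr : 0 < ‖ζ‖ := norm_pos_iff.mpr hζ0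
  have hr1 : ‖ζ‖ < 1 := by simpa using hζ
  have hrc : (‖ζ‖ : ℂ) ≠ 0 := by simpa using hζ0
  have hmem : ∀ z ∈ ball (0 : ℂ) 1, ‖(‖ζ‖ : ℂ) * z‖ < ‖ζ‖ := fun z hz => by
    rw [norm_mul, Complex.norm_real, norm_norm]
    exact mul_lt_of_lt_one_right hr (by simpa using hz)
  have hmaps : MapsTo (fun z => (‖ζ‖ : ℂ) * z) (ball 0 1) (ball 0 1) := fun z hz => by
    simpa using (hmem z hz).trans hr1
  have hF : DifferentiableOn ℂ (fun z => f (‖ζ‖ * z)) (ball 0 1) :=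
    hf.comp (differentiableOn_id.const_mul _) hmaps
  have hFinj : InjOn (fun z => f (‖ζ‖ * z)) (ball 0 1) := fun x hx y hy hxy =>
    mul_left_cancel₀ hrc (hinj (hmaps hx) (hmaps hy) hxy)
  have hnot : f ζ ∉ (fun z => f (‖ζ‖ * z)) '' ball 0 1 := by
    rintro ⟨z, hz, h⟩
    exact (hmem z hz).ne (congrArg norm (hinj (hmaps hz) hζ h))
  have h := norm_deriv_zero_le_of_notMem_image hF hFinj hnot
  rw [deriv_comp_mul_left, mul_zero, smul_eq_mul, norm_mul, Complex.norm_real, norm_norm,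
    norm_sub_rev, mul_comm] at h
  exact h

/-- Koebe's bound for the pre-Schwarzian derivative of a univalent function. -/
theorem norm_deriv_deriv_div_deriv_le_of_injOn {f : ℂ → ℂ}
    (hf : DifferentiableOn ℂ f (ball 0 1)) (hinj : InjOn f (ball 0 1)) {ζ : ℂ}
    (hζ : ζ ∈ ball (0 : ℂ) 1) :
    ‖deriv (deriv f) ζ / deriv f ζ‖ ≤ (4 + 2 * ‖ζ‖) / (1 - ‖ζ‖ ^ 2) := by
  have h0 : (0 : ℂ) ∈ ball (0 : ℂ) 1 := mem_ball_self one_pos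
  have hr1 : ‖ζ‖ < 1 := by simpa using hζ
  have hs : 0 < 1 - ‖ζ‖ ^ 2 := by nlinarith [norm_nonneg ζ]
  set s : ℂ := ((1 - ‖ζ‖ ^ 2 : ℝ) : ℂ) with hsdef
  have hs' : s = 1 - ζ * starRingEnd ℂ ζ := by
    rw [hsdef, Complex.mul_conj, Complex.normSq_eq_norm_sq]
    push_cast
    ring
  have hs0 : s ≠ 0 := Complex.ofReal_ne_zero.mpr hs.ne'
  let d : ℂ → ℂ := fun z => 1 + starRingEnd ℂ ζ * z
  let φ : ℂ → ℂ := fun z => (z + ζ) / d z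
  have hd0 : ∀ z ∈ ball (0 : ℂ) 1, d z ≠ 0 := fun z hz h => by
    have hz1 : ‖z‖ < 1 := by simpa using hz
    have h1 : ‖starRingEnd ℂ ζ * z‖ = 1 := by
      rw [show starRingEnd ℂ ζ * z = -1 from by linear_combination h]
      simp
    rw [norm_mul, RCLike.norm_conj] at h1
    nlinarith [norm_nonneg ζ, norm_nonneg z]
  have hd : ∀ z, HasDerivAt d (starRingEnd ℂ ζ) z := fun z => by
    convert! ((hasDerivAt_id z).const_mul (starRingEnd ℂ ζ)).const_add 1 using 1
    rw [mul_one]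
  have hφd : ∀ z ∈ ball (0 : ℂ) 1, HasDerivAt φ (s / d z ^ 2) z := fun z hz => by
    convert! ((hasDerivAt_id z).add_const ζ).fun_div (hd z) (hd0 z hz) using 2
    simp only [d, hs', id]
    ring
  have hφ0 : φ 0 = ζ := by simp [φ, d]
  have hmaps : MapsTo φ (ball 0 1) (ball 0 1) := fun z hz => by
    have hz1 : ‖z‖ < 1 := by simpa using hz
    rw [mem_ball_zero_iff, norm_div, div_lt_one (norm_pos_iff.mpr (hd0 z hz)),
      ← sq_lt_sq₀ (norm_nonneg _) (norm_nonneg _), ← Complex.normSq_eq_norm_sq,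
      ← Complex.normSq_eq_norm_sq, ← sub_pos]
    have : Complex.normSq (d z) - Complex.normSq (z + ζ) = (1 - ‖ζ‖ ^ 2) * (1 - ‖z‖ ^ 2) := by
      simp only [d, ← Complex.normSq_eq_norm_sq, Complex.normSq_apply]
      simp
      ring
    rw [this]
    exact mul_pos hs (by nlinarith [norm_nonneg z])
  have hφinj : InjOn φ (ball 0 1) := fun x hx y hy hxy => by
    have h1 := (div_eq_div_iff (hd0 x hx) (hd0 y hy)).mp hxy
    simp only [d] at h1
    apply mul_left_cancel₀ hs0
    rw [hs']
    linear_combination h1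
  have hfd : ∀ z ∈ ball (0 : ℂ) 1, HasDerivAt f (deriv f z) z := fun z hz =>
    (hf.differentiableAt (isOpen_ball.mem_nhds hz)).hasDerivAt
  have hF : ∀ z ∈ ball (0 : ℂ) 1, HasDerivAt (f ∘ φ) (deriv f (φ z) * (s / d z ^ 2)) z :=
    fun z hz => (hfd _ (hmaps hz)).comp z (hφd z hz)
  have hF' : HasDerivAt (deriv (f ∘ φ))
      (deriv (deriv f) ζ * s ^ 2 - 2 * starRingEnd ℂ ζ * s * deriv f ζ) 0 := by
    have h1 : HasDerivAt (deriv f) (deriv (deriv f) (φ 0)) (φ 0) :=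
      ((hf.deriv isOpen_ball).differentiableAt
        (isOpen_ball.mem_nhds (hmaps h0))).hasDerivAt
    have h2 := (h1.comp 0 (hφd 0 h0)).mul
      ((hasDerivAt_const 0 s).fun_div ((hd 0).fun_pow 2) (pow_ne_zero 2 (hd0 0 h0)))
    have h3 : deriv (f ∘ φ) =ᶠ[𝓝 0] fun z => deriv f (φ z) * (s / d z ^ 2) := by
      filter_upwards [isOpen_ball.mem_nhds h0] with z hz using (hF z hz).deriv
    refine HasDerivAt.congr_of_eventuallyEq ?_ h3
    convert! h2 using 1
    simp [hφ0, d]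
    ring
  have hB := norm_deriv_deriv_zero_le_of_injOn (f := f ∘ φ)
    (fun z hz => (hF z hz).differentiableAt.differentiableWithinAt)
    (hinj.comp hφinj hmaps)
  have hf0 : deriv f ζ ≠ 0 := deriv_ne_zero_of_injOn_of_isOpen isOpen_ball hf hinj hζ
  have hfp := norm_pos_iff.mpr hf0
  have hns : ‖s‖ = 1 - ‖ζ‖ ^ 2 := by
    rw [hsdef, Complex.norm_real, Real.norm_of_nonneg hs.le]
  have hF0 : deriv (f ∘ φ) 0 = deriv f ζ * s := by
    rw [(hF 0 h0).deriv, hφ0]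
    simp [d]
  rw [hF'.deriv, hF0] at hB
  have h4 := norm_le_norm_sub_add (deriv (deriv f) ζ * s ^ 2)
    (2 * starRingEnd ℂ ζ * s * deriv f ζ)
  simp only [norm_mul, norm_pow, RCLike.norm_conj, Complex.norm_ofNat, hns] at hB h4
  rw [norm_div, div_le_div_iff₀ hfp hs]
  refine le_of_mul_le_mul_right ?_ hs
  linarith

/-- The upper bound in the **growth theorem** for univalent functions. -/
theorem norm_sub_le_of_injOn {f : ℂ → ℂ} (hf : DifferentiableOn ℂ f (ball 0 1))
    (hinj : InjOn f (ball 0 1)) {ζ : ℂ} (hζ : ζ ∈ ball (0 : ℂ) 1) :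
    ‖f ζ - f 0‖ ≤ ‖deriv f 0‖ * (‖ζ‖ / (1 - ‖ζ‖) ^ 2) := by
  rcases eq_or_ne ζ 0 with rfl | hζ0
  · simp
  have hr : 0 < ‖ζ‖ := norm_pos_iff.mpr hζ0
  have hr1 : ‖ζ‖ < 1 := by simpa using hζ
  obtain ⟨L, hL0, hL, hLf⟩ := exists_log_of_differentiableOn_ball (hf.deriv isOpen_ball)
    fun z hz => deriv_ne_zero_of_injOn_of_isOpen isOpen_ball hf hinj hz
  set e : ℂ := ζ / ‖ζ‖ with he
  have hne : ‖e‖ = 1 := by simp [he, hr.ne']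
  have hnorm : ∀ t : ℝ, 0 ≤ t → ‖(t : ℂ) * e‖ = t := fun t ht => by
    rw [norm_mul, hne, mul_one, Complex.norm_real, Real.norm_of_nonneg ht]
  have hmem : ∀ t : ℝ, 0 ≤ t → t ≤ ‖ζ‖ → (t : ℂ) * e ∈ ball (0 : ℂ) 1 := fun t ht ht1 => by
    rw [mem_ball_zero_iff, hnorm t ht]
    exact ht1.trans_lt hr1
  have hray : ∀ t : ℝ, HasDerivAt (fun t : ℝ => (t : ℂ) * e) e t := fun t => by
    simpa using (Complex.ofRealCLM.hasDerivAt (x := t)).mul_const e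
  have hLray : ∀ t ∈ Icc (0 : ℝ) ‖ζ‖, HasDerivAt (fun t : ℝ => L (t * e))
      (deriv (deriv f) (t * e) / deriv f (t * e) * e) t := fun t ht =>
    (hL _ (hmem t ht.1 ht.2)).comp t (hray t)
  have hfray : ∀ t ∈ Icc (0 : ℝ) ‖ζ‖, HasDerivAt (fun t : ℝ => f (t * e) - f 0)
      (deriv f (t * e) * e) t := fun t ht =>
    ((hf.differentiableAt (isOpen_ball.mem_nhds
      (hmem t ht.1 ht.2))).hasDerivAt.comp t (hray t)).sub_const (f 0)
  have hdist : ∀ t ∈ Icc (0 : ℝ) ‖ζ‖,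
      ‖L (t * e)‖ ≤ Real.log (1 + t) - 3 * Real.log (1 - t) := by
    have hB : ∀ t ∈ Icc (0 : ℝ) ‖ζ‖, HasDerivAt
        (fun t : ℝ => Real.log (1 + t) - 3 * Real.log (1 - t))
        ((4 + 2 * t) / (1 - t ^ 2)) t := fun t ht => by
      have h1 : 1 + t ≠ 0 := by linarith [ht.1]
      have h2 : 1 - t ≠ 0 := by linarith [ht.2]
      have h3 : 1 - t ^ 2 ≠ 0 := by
        rw [show 1 - t ^ 2 = (1 + t) * (1 - t) by ring]
        exact mul_ne_zero h1 h2
      convert! (((hasDerivAt_id t).const_add 1).log h1).fun_sub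
        ((((hasDerivAt_id t).const_sub 1).log h2).const_mul 3) using 1
      simp only [id]
      field_simp
      ring
    refine image_norm_le_of_norm_deriv_right_le_deriv_boundary'
      (fun t ht => (hLray t ht).continuousAt.continuousWithinAt)
      (fun t ht => (hLray t (Ico_subset_Icc_self ht)).hasDerivWithinAt) (by simp [hL0])
      (fun t ht => (hB t ht).continuousAt.continuousWithinAt)
      (fun t ht => (hB t (Ico_subset_Icc_self ht)).hasDerivWithinAt) fun t ht => ?_
    rw [norm_mul, hne, mul_one]
    have h := norm_deriv_deriv_div_deriv_le_of_injOn hf hinj (hmem t ht.1 ht.2.le)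
    rwa [hnorm t ht.1] at h
  have hf' : ∀ t ∈ Icc (0 : ℝ) ‖ζ‖,
      ‖deriv f (t * e)‖ ≤ ‖deriv f 0‖ * ((1 + t) / (1 - t) ^ 3) := fun t ht => by
    have h1 : 0 < 1 + t := by linarith [ht.1]
    have h2 : 0 < 1 - t := by linarith [ht.2]
    rw [hLf _ (hmem t ht.1 ht.2), norm_mul]
    gcongr
    calc ‖Complex.exp (L (t * e))‖ ≤ Real.exp ‖L (t * e)‖ := by
          rw [Complex.norm_exp]
          exact Real.exp_le_exp.mpr (Complex.re_le_norm _)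
      _ ≤ Real.exp (Real.log (1 + t) - 3 * Real.log (1 - t)) := Real.exp_le_exp.mpr (hdist t ht)
      _ = (1 + t) / (1 - t) ^ 3 := by
          rw [Real.exp_sub, Real.exp_log h1, mul_comm, Real.exp_mul, Real.exp_log h2]
          norm_cast
  have hB : ∀ t ∈ Icc (0 : ℝ) ‖ζ‖, HasDerivAt
      (fun t : ℝ => ‖deriv f 0‖ * (t / (1 - t) ^ 2))
      (‖deriv f 0‖ * ((1 + t) / (1 - t) ^ 3)) t := fun t ht => by
    have h2 : 1 - t ≠ 0 := by linarith [ht.2]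
    convert! ((hasDerivAt_id t).fun_div (((hasDerivAt_id t).const_sub 1).fun_pow 2)
      (pow_ne_zero 2 h2)).const_mul ‖deriv f 0‖ using 2
    simp only [id]
    field_simp
    ring
  have h := image_norm_le_of_norm_deriv_right_le_deriv_boundary'
    (fun t ht => (hfray t ht).continuousAt.continuousWithinAt)
    (fun t ht => (hfray t (Ico_subset_Icc_self ht)).hasDerivWithinAt) (by simp)
    (fun t ht => (hB t ht).continuousAt.continuousWithinAt)
    (fun t ht => (hB t (Ico_subset_Icc_self ht)).hasDerivWithinAt)
    (fun t ht => by
      rw [norm_mul, hne, mul_one]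
      exact hf' t (Ico_subset_Icc_self ht)) (right_mem_Icc.mpr hr.le)
  rwa [he, mul_div_cancel₀ _ (by simpa using hζ0)] at h

/-- If `f` is holomorphic and injective on the open unit disc with
`f 0 = w` and `f' 0 = c > 0`, then `|f ζ − w| ≥ c |ζ| / 4` for every `ζ` in the disc, and
`|f ζ − w| ≤ 4 c |ζ|` whenever additionally `|ζ| ≤ 1/2`. -/
theorem cle_gasket_stmt_2
    (f : ℂ → ℂ) (hf_holo : DifferentiableOn ℂ f (ball (0 : ℂ) 1))
    (hf_inj : InjOn f (ball (0 : ℂ) 1))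
    (w : ℂ) (hf0 : f 0 = w)
    (c : ℝ) (hc : 0 < c) (hf'0 : deriv f 0 = (c : ℂ)) :
    (∀ ζ ∈ ball (0 : ℂ) 1, c * ‖ζ‖ / 4 ≤ ‖f ζ - w‖) ∧
    (∀ ζ ∈ ball (0 : ℂ) 1, ‖ζ‖ ≤ 1 / 2 →
      ‖f ζ - w‖ ≤ 4 * c * ‖ζ‖) := by
  have hnc : ‖deriv f 0‖ = c := by rw [hf'0, Complex.norm_real, Real.norm_of_nonneg hc.le]
  subst hf0
  refine ⟨fun ζ hζ => ?_, fun ζ hζ hle => ?_⟩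
  · have h := norm_deriv_zero_mul_norm_le_of_injOn hf_holo hf_inj hζ
    rw [hnc] at h
    linarith
  · have h := norm_sub_le_of_injOn hf_holo hf_inj hζ
    rw [hnc] at h
    refine h.trans ?_
    have h1 : 0 < (1 - ‖ζ‖) ^ 2 := pow_pos (by linarith) 2
    have h2 : ‖ζ‖ / (1 - ‖ζ‖) ^ 2 ≤ 4 * ‖ζ‖ := by
      rw [div_le_iff₀ h1]
      nlinarith [norm_nonneg ζ, mul_nonneg (norm_nonneg ζ)
        (mul_nonneg (by linarith : (0 : ℝ) ≤ 1 - 2 * ‖ζ‖) (by linarith : (0 : ℝ) ≤ 3 - 2 * ‖ζ‖))]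
    nlinarith
end

section
/- Let o and o' be complex numbers with |o| = |o'| = 1, o ≠ 1, and o' ≠ 1. Define the Möbius transformation f(ζ) = (o'/o)·((o + ō' − 2)·ζ + (1 − o·ō')) / ((ō + o' − 2) + (1 − ō·o')·ζ), where ō denotes the complex conjugate of o. Then the denominator (ō + o' − 2) + (1 − ō·o')·ζ is nonzero for every ζ in the closed unit disc, f maps the open unit disc 𝔻 bijectively onto 𝔻, and f(1) = 1, f(o) = o', f(ō') = ō. -/
open Metric Set

/-- The Möbius transformation
`f_{o o'}(ζ) = (o'/o) · ((o + ō' − 2) ζ + (1 − o ō')) / ((ō + o' − 2) + (1 − ō o') ζ)`,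
the automorphism of the unit disc fixing `1`, sending `o` to `o'` and `ō'` to `ō`. -/
noncomputable def cleGasketMoebius (o o' ζ : ℂ) : ℂ :=
  (o' / o) * ((o + (starRingEnd ℂ) o' - 2) * ζ + (1 - o * (starRingEnd ℂ) o')) /
    (((starRingEnd ℂ) o + o' - 2) + (1 - (starRingEnd ℂ) o * o') * ζ)

open ComplexConjugate in
theorem Complex.normSq_add_mul_sub_normSq_conj_mul_add_conj (A B z : ℂ) :
    normSq (A + B * z) - normSq (conj A * z + conj B) =
      (normSq A - normSq B) * (1 - normSq z) := by
  simp only [normSq_apply, add_re, add_im, mul_re, mul_im, conj_re, conj_im]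
  ring

theorem Complex.add_mul_ne_zero_of_norm_lt {A B z : ℂ} (h : ‖B‖ < ‖A‖) (hz : ‖z‖ ≤ 1) :
    A + B * z ≠ 0 := by
  intro h0
  have h1 : ‖A‖ = ‖B‖ * ‖z‖ := by
    rw [eq_neg_of_add_eq_zero_left h0, norm_neg, norm_mul]
  nlinarith [norm_nonneg B]

open ComplexConjugate in
theorem Complex.norm_conj_mul_add_conj_div_lt_one {A B z : ℂ} (h : ‖B‖ < ‖A‖) (hz : ‖z‖ < 1) :
    ‖(conj A * z + conj B) / (A + B * z)‖ < 1 := by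
  have hd := norm_pos_iff.2 (add_mul_ne_zero_of_norm_lt h hz.le)
  rw [norm_div, div_lt_one hd]
  have key := normSq_add_mul_sub_normSq_conj_mul_add_conj A B z
  simp only [normSq_eq_norm_sq] at key
  have h1 : 0 < ‖A‖ ^ 2 - ‖B‖ ^ 2 := by nlinarith [norm_nonneg B]
  have h2 : 0 < 1 - ‖z‖ ^ 2 := by nlinarith [norm_nonneg z]
  exact lt_of_pow_lt_pow_left₀ 2 hd.le (by nlinarith [mul_pos h1 h2])

open ComplexConjugate in
/-- `z ↦ (conj A * z + conj B) / (A + B * z)` is an automorphism of the unit disc. -/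
theorem Complex.bijOn_ball_conj_mul_add_conj_div {A B : ℂ} (h : ‖B‖ < ‖A‖) :
    BijOn (fun z ↦ (conj A * z + conj B) / (A + B * z)) (ball 0 1) (ball 0 1) := by
  have hdet : A * conj A - B * conj B ≠ 0 := by
    rw [mul_conj, mul_conj, ← ofReal_sub, ofReal_ne_zero, normSq_eq_norm_sq, normSq_eq_norm_sq]
    have : 0 < ‖A‖ ^ 2 - ‖B‖ ^ 2 := by nlinarith [norm_nonneg B]
    exact this.ne'
  have h' : ‖-B‖ < ‖conj A‖ := by simpa using h
  refine ⟨fun z hz ↦ ?_, fun z hz w hw hzw ↦ ?_, fun w hw ↦ ?_⟩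
  · rw [mem_ball_zero_iff] at hz ⊢
    exact norm_conj_mul_add_conj_div_lt_one h hz
  · rw [mem_ball_zero_iff] at hz hw
    have hz0 := add_mul_ne_zero_of_norm_lt h hz.le
    have hw0 := add_mul_ne_zero_of_norm_lt h hw.le
    rw [div_eq_div_iff hz0 hw0] at hzw
    exact mul_left_cancel₀ hdet (by linear_combination hzw)
  · rw [mem_ball_zero_iff] at hw
    have hw0 := add_mul_ne_zero_of_norm_lt h' hw.le
    have hlt := norm_conj_mul_add_conj_div_lt_one h' hw
    simp only [conj_conj, map_neg] at hlt
    refine ⟨_, mem_ball_zero_iff.2 hlt, ?_⟩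
    have hd := add_mul_ne_zero_of_norm_lt h hlt.le
    have hz := div_mul_cancel₀ (A * w + -conj B) hw0
    rw [div_eq_iff hd]
    exact mul_right_cancel₀ hw0 (by linear_combination (conj A - w * B) * hz)

theorem Complex.bijOn_ball_const_mul {c : ℂ} (hc : ‖c‖ = 1) :
    BijOn (fun z ↦ c * z) (ball 0 1) (ball 0 1) := by
  have hc0 : c ≠ 0 := norm_ne_zero_iff.1 (by simp [hc])
  refine ⟨fun z hz ↦ ?_, (mul_right_injective₀ hc0).injOn, fun w hw ↦ ⟨c⁻¹ * w, ?_, ?_⟩⟩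
  · simpa [hc] using hz
  · simpa [hc] using hw
  · exact mul_inv_cancel_left₀ hc0 w

theorem norm_one_sub_conj_mul_lt_norm_conj_add_sub_two {o o' : ℂ}
    (ho : ‖o‖ = 1) (ho' : ‖o'‖ = 1) (ho1 : o ≠ 1) (ho'1 : o' ≠ 1) :
    ‖1 - (starRingEnd ℂ) o * o'‖ < ‖(starRingEnd ℂ) o + o' - 2‖ := by
  have h1 : o.re * o.re + o.im * o.im = 1 := by
    rw [← Complex.normSq_apply, Complex.normSq_eq_norm_sq, ho, one_pow]
  have h2 : o'.re * o'.re + o'.im * o'.im = 1 := by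
    rw [← Complex.normSq_apply, Complex.normSq_eq_norm_sq, ho', one_pow]
  have key : Complex.normSq ((starRingEnd ℂ) o + o' - 2) -
      Complex.normSq (1 - (starRingEnd ℂ) o * o') =
        Complex.normSq (o - 1) * Complex.normSq (o' - 1) := by
    simp only [Complex.normSq_apply, Complex.add_re, Complex.add_im, Complex.sub_re,
      Complex.sub_im, Complex.mul_re, Complex.mul_im, Complex.conj_re, Complex.conj_im,
      Complex.one_re, Complex.one_im, Complex.re_ofNat, Complex.im_ofNat]
    linear_combination (2 * o'.re - 2 * (o'.re ^ 2 + o'.im ^ 2)) * h1 + (2 * o.re - 2) * h2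
  have hpos := mul_pos (Complex.normSq_pos.2 (sub_ne_zero.2 ho1))
    (Complex.normSq_pos.2 (sub_ne_zero.2 ho'1))
  rw [← key, Complex.normSq_eq_norm_sq, Complex.normSq_eq_norm_sq] at hpos
  exact lt_of_pow_lt_pow_left₀ 2 (norm_nonneg _) (sub_pos.1 hpos)

/-- For `o, o'` on the unit circle, both different from `1`, the
denominator of `f_{o o'}` does not vanish on the closed unit disc, `f_{o o'}` maps the
open unit disc bijectively onto itself, and `f 1 = 1`, `f o = o'`, `f ō' = ō`. -/
theorem cle_gasket_stmt_5 (o o' : ℂ)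
    (ho : ‖o‖ = 1) (ho' : ‖o'‖ = 1)
    (ho1 : o ≠ 1) (ho'1 : o' ≠ 1) :
    (∀ ζ ∈ closedBall (0 : ℂ) 1,
      ((starRingEnd ℂ) o + o' - 2) + (1 - (starRingEnd ℂ) o * o') * ζ ≠ 0) ∧
    BijOn (cleGasketMoebius o o') (ball (0 : ℂ) 1) (ball (0 : ℂ) 1) ∧
    cleGasketMoebius o o' 1 = 1 ∧
    cleGasketMoebius o o' o = o' ∧
    cleGasketMoebius o o' ((starRingEnd ℂ) o') = (starRingEnd ℂ) o := by
  have hlt := norm_one_sub_conj_mul_lt_norm_conj_add_sub_two ho ho' ho1 ho'1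
  have hden : ∀ ζ ∈ closedBall (0 : ℂ) 1,
      ((starRingEnd ℂ) o + o' - 2) + (1 - (starRingEnd ℂ) o * o') * ζ ≠ 0 := fun ζ hζ ↦
    Complex.add_mul_ne_zero_of_norm_lt hlt (mem_closedBall_zero_iff.1 hζ)
  have ho0 : o ≠ 0 := norm_ne_zero_iff.1 (by simp [ho])
  have hoc : o * (starRingEnd ℂ) o = 1 := by
    rw [Complex.mul_conj, Complex.normSq_eq_norm_sq, ho]; simp
  have hoc' : o' * (starRingEnd ℂ) o' = 1 := by
    rw [Complex.mul_conj, Complex.normSq_eq_norm_sq, ho']; simp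
  have hdiv : o' / o = o' * (starRingEnd ℂ) o := by
    rw [div_eq_iff ho0]; linear_combination -o' * hoc
  refine ⟨hden, ?_, ?_, ?_, ?_⟩
  · convert (Complex.bijOn_ball_const_mul (c := o' / o) (by simp [ho, ho'])).comp
      (Complex.bijOn_ball_conj_mul_add_conj_div hlt) using 1
    funext ζ
    simp [cleGasketMoebius, mul_div_assoc, map_ofNat (starRingEnd ℂ)]
  · rw [cleGasketMoebius, div_eq_iff (hden 1 (by simp)), hdiv]
    linear_combination (o' - o' * (starRingEnd ℂ) o') * hoc + ((starRingEnd ℂ) o - 1) * hoc'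
  · rw [cleGasketMoebius, div_eq_iff (hden o (by simp [ho])), hdiv]
    linear_combination (o' * o - 2 * o' + o' * o') * hoc
  · rw [cleGasketMoebius, div_eq_iff (hden _ (by simp [ho'])), hdiv]
    linear_combination ((starRingEnd ℂ) o * ((starRingEnd ℂ) o' - 2 + (starRingEnd ℂ) o)) * hoc'
end

section
/- Let c₀ ∈ (0, π), let θ₀ ∈ [c₀, 2π − c₀], let o = e^{iθ₀}, and let f(ζ) = i·(ζ − 1)·(o − 1)/(2·(ζ − o)). Then: (i) for every ζ ≠ o, f'(ζ) = −i·(o − 1)²/(2·(ζ − o)²); (ii) for every ζ in the open unit disc 𝔻, |f'(ζ)| ≥ |o − 1|²/8 ≥ sin²(c₀/2)/2; and (iii) consequently the inverse map f^{−1} from the upper half-plane ℍ onto 𝔻 is Lipschitz with Lipschitz constant 2/sin²(c₀/2), i.e., |f^{−1}(u) − f^{−1}(v)| ≤ (2/sin²(c₀/2))·|u − v| for all u, v ∈ ℍ. -/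
open Metric Set

theorem Real.cos_le_cos_of_mem_Icc_two_pi_sub {c θ : ℝ} (hc : 0 ≤ c)
    (hθ : θ ∈ Icc c (2 * Real.pi - c)) : Real.cos θ ≤ Real.cos c := by
  rcases le_total θ Real.pi with h | h
  · exact Real.cos_le_cos_of_nonneg_of_le_pi hc h hθ.1
  · rw [← Real.cos_two_pi_sub θ]
    exact Real.cos_le_cos_of_nonneg_of_le_pi hc (by linarith) (by linarith [hθ.2])

theorem Complex.norm_exp_I_mul_sub_one_sq (θ : ℝ) :
    ‖Complex.exp (Complex.I * θ) - 1‖ ^ 2 = 2 - 2 * Real.cos θ := by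
  rw [mul_comm, Complex.exp_mul_I, ← Complex.normSq_eq_norm_sq, Complex.normSq_apply]
  simp [← Complex.ofReal_cos, ← Complex.ofReal_sin]
  nlinarith [Real.sin_sq_add_cos_sq θ]

/-- For `c₀ ∈ (0, π)`, `θ₀ ∈ [c₀, 2π − c₀]`, `o = e^{iθ₀}`, and
`f(ζ) = i (ζ − 1)(o − 1)/(2 (ζ − o))`:
(i) `f'(ζ) = −i (o − 1)²/(2 (ζ − o)²)` for all `ζ ≠ o`;
(ii) `|f'(ζ)| ≥ |o − 1|²/8 ≥ sin²(c₀/2)/2` on the unit disc; and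
(iii) the inverse map `f⁻¹ : ℍ → 𝔻` is Lipschitz with constant `2/sin²(c₀/2)`,
expressed here as: for `x, y ∈ 𝔻`, `|x − y| ≤ (2/sin²(c₀/2)) |f x − f y|`. -/
theorem cle_gasket_stmt_8 (c₀ θ₀ : ℝ)
    (hc₀ : c₀ ∈ Ioo 0 Real.pi)
    (hθ₀ : θ₀ ∈ Icc c₀ (2 * Real.pi - c₀))
    (o : ℂ) (ho : o = Complex.exp (Complex.I * θ₀))
    (f : ℂ → ℂ)
    (hf : f = fun ζ : ℂ => Complex.I * (ζ - 1) * (o - 1) / (2 * (ζ - o))) :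
    (∀ ζ : ℂ, ζ ≠ o → deriv f ζ = -Complex.I * (o - 1) ^ 2 / (2 * (ζ - o) ^ 2)) ∧
    (∀ ζ ∈ ball (0 : ℂ) 1,
      Real.sin (c₀ / 2) ^ 2 / 2 ≤ ‖o - 1‖ ^ 2 / 8 ∧
      ‖o - 1‖ ^ 2 / 8 ≤ ‖deriv f ζ‖) ∧
    (∀ x ∈ ball (0 : ℂ) 1, ∀ y ∈ ball (0 : ℂ) 1,
      ‖x - y‖ ≤ 2 / Real.sin (c₀ / 2) ^ 2 * ‖f x - f y‖) := by
  have hnorm : ‖o‖ = 1 := by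
    rw [ho, mul_comm, Complex.norm_exp_ofReal_mul_I]
  have hsin : 0 < Real.sin (c₀ / 2) :=
    Real.sin_pos_of_pos_of_lt_pi (by linarith [hc₀.1]) (by linarith [hc₀.1, hc₀.2])
  have hlow : 4 * Real.sin (c₀ / 2) ^ 2 ≤ ‖o - 1‖ ^ 2 := by
    have h := Real.cos_le_cos_of_mem_Icc_two_pi_sub hc₀.1.le hθ₀
    rw [ho, Complex.norm_exp_I_mul_sub_one_sq, Real.sin_sq_eq_half_sub,
      mul_div_cancel₀ c₀ two_ne_zero]
    linarith
  have hne : ∀ z ∈ ball (0 : ℂ) 1, z ≠ o := by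
    rintro z hz rfl
    exact (mem_ball_zero_iff.1 hz).ne hnorm
  have hpos : ∀ z ∈ ball (0 : ℂ) 1, 0 < ‖z - o‖ := fun z hz =>
    norm_pos_iff.2 (sub_ne_zero.2 (hne z hz))
  have hle : ∀ z ∈ ball (0 : ℂ) 1, ‖z - o‖ ≤ 2 := fun z hz => by
    linarith [norm_sub_le z o, mem_ball_zero_iff.1 hz]
  have hderiv : ∀ ζ : ℂ, ζ ≠ o →
      deriv f ζ = -Complex.I * (o - 1) ^ 2 / (2 * (ζ - o) ^ 2) := by
    intro ζ hζ
    have hζo : ζ - o ≠ 0 := sub_ne_zero.2 hζ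
    have h := ((((hasDerivAt_id ζ).sub_const 1).const_mul Complex.I).mul_const (o - 1)).div
      (((hasDerivAt_id ζ).sub_const o).const_mul 2) (mul_ne_zero two_ne_zero hζo)
    rw [hf]
    refine h.deriv.trans ?_
    simp only [id]
    field_simp
    ring
  refine ⟨hderiv, fun ζ hζ => ⟨by linarith, ?_⟩, fun x hx y hy => ?_⟩
  · have hp := hpos ζ hζ
    have hn : ‖deriv f ζ‖ = ‖o - 1‖ ^ 2 / (2 * ‖ζ - o‖ ^ 2) := by
      rw [hderiv ζ (hne ζ hζ)]
      simp
    rw [hn]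
    gcongr
    nlinarith [hle ζ hζ]
  · have hxp := hpos x hx
    have hyp := hpos y hy
    have hdiff : f x - f y =
        -Complex.I * (o - 1) ^ 2 * (x - y) / (2 * ((x - o) * (y - o))) := by
      have hxo : x - o ≠ 0 := sub_ne_zero.2 (hne x hx)
      have hyo : y - o ≠ 0 := sub_ne_zero.2 (hne y hy)
      rw [hf]
      field_simp
      ring
    have hn : ‖f x - f y‖ = ‖o - 1‖ ^ 2 * ‖x - y‖ / (2 * (‖x - o‖ * ‖y - o‖)) := by
      rw [hdiff]
      simp
    have hprod : ‖x - o‖ * ‖y - o‖ ≤ 4 := by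
      nlinarith [hle x hx, hle y hy]
    have hbound : Real.sin (c₀ / 2) ^ 2 / 2 * ‖x - y‖ ≤ ‖f x - f y‖ := by
      rw [hn]
      calc Real.sin (c₀ / 2) ^ 2 / 2 * ‖x - y‖
          = 4 * Real.sin (c₀ / 2) ^ 2 * ‖x - y‖ / (2 * 4) := by ring
        _ ≤ _ := by gcongr
    rw [div_mul_eq_mul_div, le_div_iff₀ (by positivity)]
    linarith
end

section
/- Let (B_t)_{t≥0} be a standard one-dimensional Brownian motion, let T > 0, let φ : [0, T] → ℝ be a continuous function with φ(0) = 0, and let δ > 0. Then the event { |B_t − φ(t)| ≤ δ for all t ∈ [0, T] } has positive probability. -/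
open MeasureTheory ProbabilityTheory Set

/-- A standard one-dimensional Brownian motion on `[0, ∞)`: a real-valued process with
continuous sample paths, starting at `0`, whose increments over `0 ≤ s ≤ t` are Gaussian
`N(0, t − s)`, and whose increments over disjoint consecutive time intervals are
independent. -/
structure IsStandardBrownianMotion {Ω : Type*} [MeasurableSpace Ω] (P : Measure Ω)
    (B : ℝ → Ω → ℝ) : Prop where
  isProbabilityMeasure : IsProbabilityMeasure P
  measurable : ∀ t : ℝ, Measurable (B t)
  continuous_paths : ∀ ω, ContinuousOn (fun t => B t ω) (Ici (0 : ℝ))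
  start_at_zero : ∀ ω, B 0 ω = 0
  gaussian_increments : ∀ s t : ℝ, 0 ≤ s → s ≤ t →
    Measure.map (fun ω => B t ω - B s ω) P = gaussianReal 0 (Real.toNNReal (t - s))
  indep_increments : ∀ (n : ℕ) (ts : ℕ → ℝ), (∀ i, 0 ≤ ts i) → Monotone ts →
    iIndepFun
      (fun (i : Fin n) ω => B (ts (i.1 + 1)) ω - B (ts i.1) ω) P

open scoped NNReal ENNReal
open Filter TopologicalSpace

lemma IsStandardBrownianMotion.isPreBrownianReal {Ω : Type*} [MeasurableSpace Ω] {P : Measure Ω}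
    {B : ℝ → Ω → ℝ} (hB : IsStandardBrownianMotion P B) :
    IsPreBrownianReal (fun t : ℝ≥0 => B t) P := by
  refine HasIndepIncrements.isPreBrownianReal_of_hasLaw (fun t => ?_) (fun n t ht => ?_)
  · refine ⟨(hB.measurable t).aemeasurable, ?_⟩
    simpa [hB.start_at_zero] using hB.gaussian_increments 0 t le_rfl t.2
  · let u : ℕ → ℝ := fun k => t ⟨min n k, by grind⟩
    have hu : Monotone u := fun a b hab => NNReal.coe_le_coe.2 (ht (by grind))
    convert! hB.indep_increments n u (fun i => NNReal.coe_nonneg _) hu using 3 with i ω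
    simp only [u]
    congr! 4
    · ext; simp
    · ext; simp

lemma gaussianReal_Ici_one_pos : 0 < gaussianReal 0 1 (Ici (1 : ℝ)) := by
  refine pos_iff_ne_zero.2 fun h => ?_
  have := gaussianReal_absolutelyContinuous' 0 one_ne_zero h
  simp at this

lemma gaussianReal_Ici_one_le (v : ℝ≥0) {a : ℝ} (ha : a ≤ √v) :
    gaussianReal 0 1 (Ici (1 : ℝ)) ≤ gaussianReal 0 v (Ici a) := by
  have h := gaussianReal_map_const_mul (μ := 0) (v := 1) (√v)
  have hv : (NNReal.mk (√v ^ 2) (sq_nonneg _) * 1 : ℝ≥0) = v := by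
    ext; simp
  rw [hv, mul_zero] at h
  rw [← h, Measure.map_apply (by fun_prop) measurableSet_Ici]
  refine measure_mono fun x hx => ha.trans ?_
  exact le_mul_of_one_le_right (Real.sqrt_nonneg _) hx

lemma measurable_comap_past {Ω : Type*} {X : ℝ≥0 → Ω → ℝ} {s t : ℝ≥0}
    (hst : s ≤ t) :
    Measurable[MeasurableSpace.comap (fun ω (s : Iic t) => X s ω) inferInstance] (X s) :=
  (measurable_pi_apply (⟨s, hst⟩ : Iic t)).comp
    (comap_measurable (fun ω (u : Iic t) => X u ω))

lemma comap_past_mono {Ω : Type*} (X : ℝ≥0 → Ω → ℝ) {s t : ℝ≥0}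
    (hst : s ≤ t) :
    MeasurableSpace.comap (fun ω (u : Iic s) => X u ω) inferInstance ≤
      MeasurableSpace.comap (fun ω (u : Iic t) => X u ω) inferInstance := by
  refine Measurable.comap_le ?_
  exact @measurable_pi_lambda _ _ _ (_) _ _ fun u => measurable_comap_past (u.2.trans hst)

section

variable {Ω : Type*} [MeasurableSpace Ω] {P : Measure Ω} {X : ℝ≥0 → Ω → ℝ}

/-- Small oscillation of continuous paths at small scales has probability close to one. -/
lemma exists_modulus_measure_gt [IsProbabilityMeasure P] (hX : ∀ ω, Continuous (X · ω))
    (T : ℝ≥0) {ε : ℝ} (hε : 0 < ε) {r : ℝ≥0∞} (hr : r < 1) :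
    ∃ η > 0, r < P {ω | ∀ s ≤ T, ∀ t ≤ T, dist s t ≤ η → |X t ω - X s ω| ≤ ε} := by
  let D : ℕ → Set Ω := fun m =>
    {ω | ∀ s ≤ T, ∀ t ≤ T, dist s t ≤ 1 / ((m : ℝ) + 1) → |X t ω - X s ω| ≤ ε}
  have hmono : Monotone D := fun m n hmn ω hω s hs t ht hst =>
    hω s hs t ht (hst.trans (Nat.one_div_le_one_div hmn))
  have hU : ⋃ m, D m = univ := by
    refine eq_univ_of_forall fun ω => mem_iUnion.2 ?_
    have huc := isCompact_Icc.uniformContinuousOn_of_continuous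
      (hX ω).continuousOn (s := Icc 0 T)
    obtain ⟨η, hη, h⟩ := Metric.uniformContinuousOn_iff_le.1 huc ε hε
    obtain ⟨m, hm⟩ := exists_nat_one_div_lt hη
    refine ⟨m, fun s hs t ht hst => ?_⟩
    rw [abs_sub_comm]
    exact h s ⟨zero_le, hs⟩ t ⟨zero_le, ht⟩ (hst.trans hm.le)
  have hlim := tendsto_measure_iUnion_atTop (μ := P) hmono
  rw [hU, measure_univ] at hlim
  obtain ⟨m, hm⟩ := (hlim.eventually (lt_mem_nhds hr)).exists
  exact ⟨1 / ((m : ℝ) + 1), by positivity, hm⟩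

/-- Paths staying within `ε` of the origin up to time `h`, with endpoint at distance at least `a`
from the origin in the direction `σ`. -/
def steeredPaths (ε a σ : ℝ) (h : ℝ≥0) : Set (ℝ≥0 → ℝ) :=
  {x | (∀ n, |x (min (denseSeq ℝ≥0 n) h)| ≤ ε) ∧ a ≤ σ * x h}

lemma measurableSet_steeredPaths (ε a σ : ℝ) (h : ℝ≥0) :
    MeasurableSet (steeredPaths ε a σ h) := by
  unfold steeredPaths
  measurability

lemma abs_le_of_mem_steeredPaths {ε a σ : ℝ} {h : ℝ≥0} {x : ℝ≥0 → ℝ} (hx : Continuous x)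
    (hmem : x ∈ steeredPaths ε a σ h) {s : ℝ≥0} (hs : s ≤ h) : |x s| ≤ ε := by
  have hcl : IsClosed {s : ℝ≥0 | |x (min s h)| ≤ ε} :=
    isClosed_le (by fun_prop) continuous_const
  have := (denseRange_denseSeq ℝ≥0).induction_on (p := fun s => |x (min s h)| ≤ ε) s hcl hmem.1
  rwa [min_eq_left hs] at this

lemma measure_steeredPaths_pos (hX : IsPreBrownianReal X P) {ε a σ : ℝ} (hσ : σ ^ 2 = 1)
    {t h : ℝ≥0} (ha : a ≤ √h) {D : Set Ω} (hD : 1 - gaussianReal 0 1 (Ici 1) < P D)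
    (hosc : ∀ ω ∈ D, ∀ s ≤ h, |X (t + s) ω - X t ω| ≤ ε) :
    0 < P ((fun ω s => X (t + s) ω - X t ω) ⁻¹' steeredPaths ε a σ h) := by
  have : IsProbabilityMeasure P := hX.isGaussianProcess.isProbabilityMeasure
  have hlaw : HasLaw (fun ω => σ * (X (t + h) ω - X t ω)) (gaussianReal 0 h) P := by
    have := gaussianReal_const_mul ((hX.shift t).hasLaw_eval h) σ
    have hv : (NNReal.mk (σ ^ 2) (sq_nonneg _) * h : ℝ≥0) = h := by
      ext; simp [hσ]
    rwa [hv, mul_zero] at this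
  let A : Set Ω := {ω | a ≤ σ * (X (t + h) ω - X t ω)}
  have hA : P A = gaussianReal 0 h (Ici a) := hlaw.measure_eq measurableSet_Ici
  have hsub : D ∩ A ⊆ (fun ω s => X (t + s) ω - X t ω) ⁻¹' steeredPaths ε a σ h :=
    fun ω hω => ⟨fun n => hosc ω hω.1 _ (min_le_right _ _), hω.2⟩
  refine lt_of_lt_of_le (pos_iff_ne_zero.2 fun h0 => hD.not_ge ?_) (measure_mono hsub)
  have hnull : NullMeasurableSet A P := hlaw.aemeasurable.nullMeasurableSet_preimage
    measurableSet_Ici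
  calc P D ≤ P (D ∩ A) + P Aᶜ := (measure_mono (fun ω hω => by
        by_cases hωA : ω ∈ A
        · exact Or.inl ⟨hω, hωA⟩
        · exact Or.inr hωA)).trans (measure_union_le _ _)
    _ = 1 - gaussianReal 0 h (Ici a) := by
        rw [h0, zero_add, measure_compl₀ hnull (measure_ne_top _ _), measure_univ, hA]
    _ ≤ 1 - gaussianReal 0 1 (Ici 1) := tsub_le_tsub_left (gaussianReal_Ici_one_le h ha) _

/-- Intersecting an event of the past of `t` with a steered continuation after `t` keeps its
probability positive. -/
lemma measure_inter_steeredPaths_pos (hX : IsPreBrownianReal X P) {ε a σ : ℝ} (hσ : σ ^ 2 = 1)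
    {t h : ℝ≥0} (ha : a ≤ √h) {D : Set Ω} (hD : 1 - gaussianReal 0 1 (Ici 1) < P D)
    (hosc : ∀ ω ∈ D, ∀ s ≤ h, |X (t + s) ω - X t ω| ≤ ε) {F : Set Ω}
    (hF : MeasurableSet[MeasurableSpace.comap (fun ω (s : Iic t) => X s ω) inferInstance] F)
    (hF0 : 0 < P F) :
    0 < P (F ∩ (fun ω s => X (t + s) ω - X t ω) ⁻¹' steeredPaths ε a σ h) := by
  have hind := (IndepFun_iff_Indep _ _ _).1 (hX.indepFun_shift t).symm
  rw [(Indep_iff _ _ _).1 hind _ _ hF ⟨_, measurableSet_steeredPaths ε a σ h, rfl⟩]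
  exact ENNReal.mul_pos hF0.ne' (measure_steeredPaths_pos hX hσ ha hD hosc).ne'

lemma exists_past_event_near (hX : IsPreBrownianReal X P) (hXc : ∀ ω, Continuous (X · ω))
    (hX0 : ∀ ω, X 0 ω = 0) {ψ : ℝ≥0 → ℝ} {ε a : ℝ} {h : ℝ≥0} {N : ℕ} (ha : a ≤ √h) (haε : a ≤ ε)
    (hψ : ∀ s t, s ≤ t → t ≤ N * h → t ≤ s + h → |ψ t - ψ s| ≤ a) (hψ0 : |ψ 0| ≤ 2 * ε)
    {D : Set Ω} (hD : 1 - gaussianReal 0 1 (Ici 1) < P D)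
    (hosc : ∀ ω ∈ D, ∀ s t, s ≤ t → t ≤ N * h → t ≤ s + h → |X t ω - X s ω| ≤ ε)
    (k : ℕ) (hk : k ≤ N) :
    ∃ F : Set Ω, MeasurableSet[MeasurableSpace.comap
        (fun ω (s : Iic (k * h : ℝ≥0)) => X s ω) inferInstance] F ∧ 0 < P F ∧
      ∀ ω ∈ F, |X (k * h) ω - ψ (k * h)| ≤ 2 * ε ∧ ∀ t ≤ k * h, |X t ω - ψ t| ≤ 4 * ε := by
  have : IsProbabilityMeasure P := hX.isGaussianProcess.isProbabilityMeasure
  induction k with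
  | zero =>
    refine ⟨univ, MeasurableSet.univ, by simp, fun ω _ => ?_⟩
    have : 0 ≤ ε := by linarith [abs_nonneg (ψ 0)]
    refine ⟨by simpa [hX0] using hψ0, fun t ht => ?_⟩
    obtain rfl : t = 0 := by simpa using ht
    simp only [hX0, zero_sub, abs_neg]
    linarith
  | succ k ih =>
    obtain ⟨F, hFm, hF0, hF⟩ := ih (by omega)
    set t₀ : ℝ≥0 := k * h with ht₀
    have ht₁ : ((k + 1 : ℕ) : ℝ≥0) * h = t₀ + h := by push_cast; ring
    have hN : t₀ + h ≤ N * h := by rw [← ht₁]; gcongr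
    rw [ht₁]
    have hoscD : ∀ ω ∈ D, ∀ s ≤ h, |X (t₀ + s) ω - X t₀ ω| ≤ ε := fun ω hω s hs =>
      hosc ω hω _ _ le_self_add ((add_le_add_right hs _).trans hN) (add_le_add_right hs _)
    obtain ⟨σ, F', hσ, hF'm, hF'0, hF'F, hsign⟩ : ∃ (σ : ℝ) (F' : Set Ω), (σ = 1 ∨ σ = -1) ∧
        MeasurableSet[MeasurableSpace.comap (fun ω (s : Iic t₀) => X s ω) inferInstance] F' ∧
        0 < P F' ∧ F' ⊆ F ∧ ∀ ω ∈ F', σ * (X t₀ ω - ψ t₀) ≤ 0 := by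
      have hE : MeasurableSet[MeasurableSpace.comap (fun ω (s : Iic t₀) => X s ω) inferInstance]
          {ω | X t₀ ω ≤ ψ t₀} := measurable_comap_past le_rfl measurableSet_Iic
      by_cases hpos : 0 < P (F ∩ {ω | X t₀ ω ≤ ψ t₀})
      · refine ⟨1, _, Or.inl rfl, MeasurableSet.inter hFm hE, hpos, inter_subset_left, ?_⟩
        rintro ω ⟨-, hω⟩
        have : X t₀ ω ≤ ψ t₀ := hω
        linarith
      · refine ⟨-1, F \ {ω | X t₀ ω ≤ ψ t₀}, Or.inr rfl, MeasurableSet.diff hFm hE, ?_,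
          sdiff_subset, ?_⟩
        · have := measure_le_inter_add_sdiff P F {ω | X t₀ ω ≤ ψ t₀}
          rw [nonpos_iff_eq_zero.1 (not_lt.1 hpos), zero_add] at this
          exact hF0.trans_le this
        · rintro ω ⟨-, hω⟩
          have : ψ t₀ < X t₀ ω := not_le.1 hω
          linarith
    have hσ2 : σ ^ 2 = 1 := by rcases hσ with rfl | rfl <;> norm_num
    refine ⟨_, ?_, measure_inter_steeredPaths_pos hX hσ2 ha hD hoscD hF'm hF'0, ?_⟩
    · refine MeasurableSet.inter (comap_past_mono X le_self_add _ hF'm) ?_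
      have hG : ∀ s ≤ h, Measurable[MeasurableSpace.comap
          (fun ω (s : Iic (t₀ + h)) => X s ω) inferInstance]
          (fun ω => X (t₀ + s) ω - X t₀ ω) := fun s hs =>
        (measurable_comap_past (add_le_add_right hs _)).sub (measurable_comap_past le_self_add)
      have hG' : (fun ω s => X (t₀ + s) ω - X t₀ ω) ⁻¹' steeredPaths ε a σ h =
          (⋂ n, (fun ω => X (t₀ + min (denseSeq ℝ≥0 n) h) ω - X t₀ ω) ⁻¹' {y | |y| ≤ ε}) ∩
            (fun ω => X (t₀ + h) ω - X t₀ ω) ⁻¹' {y | a ≤ σ * y} := by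
        ext ω; simp [steeredPaths]
      rw [hG']
      exact MeasurableSet.inter (MeasurableSet.iInter fun n => hG _ (min_le_right _ _)
        (measurableSet_le (by fun_prop) measurable_const))
        (hG h le_rfl (measurableSet_le measurable_const (by fun_prop)))
    · rintro ω ⟨hωF, hωG⟩
      have hcont : Continuous fun s => X (t₀ + s) ω - X t₀ ω :=
        ((hXc ω).comp (continuous_const.add continuous_id)).sub continuous_const
      have hsmall : ∀ s ≤ h, |X (t₀ + s) ω - X t₀ ω| ≤ ε := fun s hs =>
        abs_le_of_mem_steeredPaths hcont hωG hs
      have hdrift : ∀ s ≤ h, |ψ (t₀ + s) - ψ t₀| ≤ a := fun s hs =>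
        hψ _ _ le_self_add ((add_le_add_right hs _).trans hN) (add_le_add_right hs _)
      have hend : a ≤ σ * (X (t₀ + h) ω - X t₀ ω) := hωG.2
      obtain ⟨hgrid, hpast⟩ := hF ω (hF'F hωF)
      have hs := hsign ω hωF
      refine ⟨?_, fun t ht => ?_⟩
      · have h1 := abs_le.1 (hsmall h le_rfl)
        have h2 := abs_le.1 (hdrift h le_rfl)
        have h3 := abs_le.1 hgrid
        rw [abs_le]
        rcases hσ with rfl | rfl <;> constructor <;> linarith
      · rcases le_total t t₀ with htt | htt
        · exact hpast t htt
        · obtain ⟨s, rfl⟩ := exists_add_of_le htt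
          have hsh : s ≤ h := le_of_add_le_add_left ht
          have h1 := abs_le.1 (hsmall s hsh)
          have h2 := abs_le.1 (hdrift s hsh)
          have h3 := abs_le.1 hgrid
          rw [abs_le]
          constructor <;> linarith

end

/-- **support theorem for Brownian motion.** If `B` is a standard
one-dimensional Brownian motion, `T > 0`, `φ : [0, T] → ℝ` is continuous with `φ 0 = 0`,
and `δ > 0`, then with positive probability `|B_t − φ(t)| ≤ δ` for all `t ∈ [0, T]`. -/
theorem cle_gasket_stmt_10 {Ω : Type*} [MeasurableSpace Ω] (P : Measure Ω)
    (B : ℝ → Ω → ℝ) (hB : IsStandardBrownianMotion P B)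
    (T : ℝ) (hT : 0 < T)
    (φ : ℝ → ℝ) (hφ_cont : ContinuousOn φ (Icc 0 T)) (hφ0 : φ 0 = 0)
    (δ : ℝ) (hδ : 0 < δ) :
    0 < P {ω | ∀ t ∈ Icc (0 : ℝ) T, |B t ω - φ t| ≤ δ} := by
  have := hB.isProbabilityMeasure
  lift T to ℝ≥0 using hT.le
  let X : ℝ≥0 → Ω → ℝ := fun t => B t
  have hX : IsPreBrownianReal X P := hB.isPreBrownianReal
  have hXc : ∀ ω, Continuous (X · ω) := fun ω =>
    (hB.continuous_paths ω).comp_continuous NNReal.continuous_coe fun t => t.2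
  obtain ⟨p, hp⟩ := exists_polynomial_near_of_continuousOn 0 T φ hφ_cont (δ / 4) (by positivity)
  obtain ⟨K, hK⟩ := (p.contDiff_aeval (𝕜 := ℝ) 1).contDiffOn.exists_lipschitzOnWith one_ne_zero
    (convex_Icc (0 : ℝ) T) isCompact_Icc
  obtain ⟨η, hη, hD⟩ := exists_modulus_measure_gt (P := P) hXc T (ε := δ / 8) (by positivity)
    (r := 1 - gaussianReal 0 1 (Ici 1))
    (ENNReal.sub_lt_self ENNReal.one_ne_top one_ne_zero gaussianReal_Ici_one_pos.ne')
  have hlim : Tendsto (fun N : ℕ => (T : ℝ) / N) atTop (nhds 0) :=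
    tendsto_const_div_atTop_nhds_zero_nat _
  have hlim1 : Tendsto (fun N : ℕ => (K : ℝ) * √((T : ℝ) / N)) atTop (nhds 0) := by
    have := ((Real.continuous_sqrt.tendsto 0).comp hlim).const_mul (K : ℝ)
    rwa [Real.sqrt_zero, mul_zero] at this
  have hlim2 : Tendsto (fun N : ℕ => (K : ℝ) * ((T : ℝ) / N)) atTop (nhds 0) := by
    simpa using hlim.const_mul (K : ℝ)
  obtain ⟨N, hNη, hN1, hN2, hN0⟩ := ((hlim.eventually (gt_mem_nhds hη)).and
    ((hlim1.eventually (gt_mem_nhds one_pos)).and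
    ((hlim2.eventually (gt_mem_nhds (by positivity : 0 < δ / 8))).and
      (eventually_gt_atTop 0)))).exists
  let h : ℝ≥0 := T / N
  have hNh : N * h = T := by
    have : (N : ℝ≥0) ≠ 0 := by positivity
    simp only [h]; field_simp
  have hh : (h : ℝ) = T / N := by simp [h]
  rw [← hh] at hNη hN1 hN2
  have hdist : ∀ s t : ℝ≥0, s ≤ t → t ≤ s + h → dist s t ≤ h := fun s t hst hts => by
    have h1 : (s : ℝ) ≤ t := hst
    have h2 : (t : ℝ) ≤ s + h := hts
    rw [NNReal.dist_eq, abs_le]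
    constructor <;> linarith
  have haK : (K : ℝ) * h ≤ √h := by
    have := mul_le_mul_of_nonneg_right hN1.le (Real.sqrt_nonneg h)
    rwa [mul_assoc, Real.mul_self_sqrt h.coe_nonneg, one_mul] at this
  have hp0 : |p.eval 0| ≤ 2 * (δ / 8) := by
    have := hp 0 ⟨le_rfl, hT.le⟩
    rw [hφ0, sub_zero] at this
    linarith
  obtain ⟨F, -, hF0, hF⟩ := exists_past_event_near hX hXc hB.start_at_zero
    (ψ := fun t => p.eval (t : ℝ)) haK hN2.le
    (fun s t hst htN hts => by
      rw [hNh] at htN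
      have hle := hK.dist_le_mul (t : ℝ) ⟨t.2, htN⟩ s ⟨s.2, NNReal.coe_le_coe.2 (hst.trans htN)⟩
      rw [Real.dist_eq] at hle
      refine hle.trans (mul_le_mul_of_nonneg_left ?_ K.2)
      rw [dist_comm]
      exact hdist s t hst hts)
    (by simpa using hp0) hD
    (fun ω hω s t hst htN hts => by
      rw [hNh] at htN
      exact hω s (hst.trans htN) t htN ((hdist s t hst hts).trans hNη.le))
    N le_rfl
  refine hF0.trans_le (measure_mono fun ω hω t ht => ?_)
  have h1 := (hF ω hω).2 ⟨t, ht.1⟩ (by rw [hNh]; exact ht.2)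
  have h2 := hp t ht
  have h3 : |B t ω - p.eval t| ≤ 4 * (δ / 8) := h1
  calc |B t ω - φ t| ≤ |B t ω - p.eval t| + |p.eval t - φ t| := abs_sub_le _ _ _
    _ ≤ δ := by linarith
end
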